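/- arXiv:1912.09298 — 5 statements merged into one kernel-verified Lean document; each statement's English description precedes it below -/
import Mathlib

section
/- The structure 𝔏 admits quantifier elimination: for every first-order τ₀-formula φ(x₁,…,x_n) there exists a quantifier-free τ₀-formula ψ(x₁,…,x_n) such that for all a₁,…,a_n ∈ ℚ, φ(a₁,…,a_n) holds in 𝔏 if and only if ψ(a₁,…,a_n) holds in 𝔏. -/
open FirstOrder

/-- The signature `τ₀`: a binary relation symbol `<`, a constant symbol `1`,
and a unary function symbol `c·` for each rational number `c`. -/
@[reducible] def tau0 : FirstOrder.Language where
  Functions := fun n =>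
    match n with
    | 0 => Unit        -- the constant symbol `1`
    | 1 => ℚ           -- the unary function symbols `c·`, one for each `c : ℚ`
    | _ + 2 => Empty
  Relations := fun n =>
    match n with
    | 2 => Unit        -- the relation symbol `<`
    | 0 => Empty
    | 1 => Empty
    | _ + 3 => Empty

/-- The structure `𝔏`: domain `ℚ`, `<` the usual strict order, `1` the rational
number `1`, and `c·` multiplication by `c`. -/
instance rationalsL : tau0.Structure ℚ where
  funMap := fun {n} f x =>
    match n, f, x with
    | 0, _, _ => (1 : ℚ)
    | 1, c, x => c * x 0
    | _ + 2, f, _ => f.elim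
  RelMap := fun {n} r x =>
    match n, r, x with
    | 2, _, x => x 0 < x 1
    | 0, r, _ => r.elim
    | 1, r, _ => r.elim
    | _ + 3, r, _ => r.elim


namespace QEL

open FirstOrder.Language

/-- value of a variable, or of the constant 1 -/
def val {V : Type} (v : V → ℚ) : Option V → ℚ
  | none => 1
  | some u => v u

theorem term_nf {V : Type} (t : tau0.Term V) :
    ∃ (c : ℚ) (u : Option V), ∀ v : V → ℚ, t.realize v = c * val v u := by
  induction t with
  | var i => exact ⟨1, some i, fun v => by simp [val]⟩
  | @func l f ts ih =>
    match l, f, ts, ih with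
    | 0, _, _, _ => exact ⟨1, none, fun v => by simp [val, Term.realize, Structure.funMap]⟩
    | 1, d, ts, ih =>
      obtain ⟨c, u, h⟩ := ih 0
      refine ⟨d * c, u, fun v => ?_⟩
      have : (Term.func (L := tau0) (l := 1) d ts).realize v = d * (ts 0).realize v := rfl
      rw [this, h, mul_assoc]
    | _ + 2, f, _, _ => exact f.elim

theorem exists_term {V : Type} (c : ℚ) (u : Option V) :
    ∃ t : tau0.Term V, ∀ v : V → ℚ, t.realize v = c * val v u := by
  cases u with
  | none =>
    exact ⟨Term.func (L := tau0) (l := 1) c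
      (fun _ => Term.func (L := tau0) (l := 0) () Fin.elim0), fun v => rfl⟩
  | some i =>
    exact ⟨Term.func (L := tau0) (l := 1) c (fun _ => Term.var i), fun v => rfl⟩

/-- agreement of two valuations on all atoms with coefficients in `C` -/
def Agree {V : Type} (C : Finset ℚ) (v v' : V → ℚ) : Prop :=
  ∀ c ∈ C, ∀ d ∈ C, ∀ u w, c * val v u < d * val v w ↔ c * val v' u < d * val v' w

theorem Agree.symm {V : Type} {C : Finset ℚ} {v v' : V → ℚ} (h : Agree C v v') :
    Agree C v' v := fun c hc d hd u w => (h c hc d hd u w).symm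

theorem Agree.mono {V : Type} {C D : Finset ℚ} (hCD : C ⊆ D) {v v' : V → ℚ}
    (h : Agree D v v') : Agree C v v' :=
  fun c hc d hd u w => h c (hCD hc) d (hCD hd) u w

theorem cut {I : Type} [Finite I] (f g : I → ℚ) (h : ∀ i j, f i < f j ↔ g i < g j) (y : ℚ) :
    ∃ y', ∀ i, (y < f i ↔ y' < g i) ∧ (f i < y ↔ g i < y') := by
  classical
  have := Fintype.ofFinite I
  by_cases hy : ∃ i, f i = y
  · obtain ⟨i, rfl⟩ := hy
    exact ⟨g i, fun j => ⟨h i j, h j i⟩⟩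
  · push Not at hy
    obtain ⟨m, h1, h2⟩ := Order.exists_between_finsets
      (lo := (Finset.univ.filter (fun i => f i < y)).image g)
      (hi := (Finset.univ.filter (fun i => y < f i)).image g)
      (by
        intro a ha b hb
        simp only [Finset.mem_image, Finset.mem_filter, Finset.mem_univ, true_and] at ha hb
        obtain ⟨i, hi, rfl⟩ := ha
        obtain ⟨j, hj, rfl⟩ := hb
        exact (h i j).1 (hi.trans hj))
    have H1 : ∀ i, f i < y → g i < m := fun i hi =>
      h1 _ (Finset.mem_image_of_mem _ (by simpa using hi))
    have H2 : ∀ i, y < f i → m < g i := fun i hi =>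
      h2 _ (Finset.mem_image_of_mem _ (by simpa using hi))
    refine ⟨m, fun i => ?_⟩
    rcases lt_or_gt_of_ne (hy i) with hi | hi
    · have := H1 i hi
      exact ⟨⟨fun h => absurd h hi.not_gt, fun h => absurd h this.not_gt⟩,
        ⟨fun _ => this, fun _ => hi⟩⟩
    · have := H2 i hi
      exact ⟨⟨fun _ => this, fun _ => hi⟩,
        ⟨fun h => absurd h hi.not_gt, fun h => absurd h this.not_gt⟩⟩

theorem val_snoc {A : Type} {k : ℕ} (u : Option (A ⊕ Fin (k + 1))) :
    (∀ (a : A → ℚ) (x : Fin k → ℚ) (y : ℚ),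
      val (Sum.elim a (Fin.snoc x y : Fin (k+1) → ℚ)) u = y) ∨
    ∃ u' : Option (A ⊕ Fin k), ∀ (a : A → ℚ) (x : Fin k → ℚ) (y : ℚ),
      val (Sum.elim a (Fin.snoc x y : Fin (k+1) → ℚ)) u = val (Sum.elim a x) u' := by
  rcases u with _ | i | i
  · exact Or.inr ⟨none, fun _ _ _ => rfl⟩
  · exact Or.inr ⟨some (Sum.inl i), fun _ _ _ => rfl⟩
  · induction i using Fin.lastCases with
    | last => left; intro a x y; simp [val]
    | cast j => right; exact ⟨some (Sum.inr j), fun a x y => by simp [val]⟩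

/-- enlarged coefficient set -/
def enl (C : Finset ℚ) : Finset ℚ :=
  insert 0 (C ∪ (C ×ˢ C).image (fun p => p.1 / p.2))

theorem cmp_left {c d y y' s s' : ℚ} (hc : c ≠ 0)
    (h : (y < d / c * s ↔ y' < d / c * s') ∧ (d / c * s < y ↔ d / c * s' < y')) :
    (c * y < d * s ↔ c * y' < d * s') ∧ (d * s < c * y ↔ d * s' < c * y') := by
  have e : d * s = c * (d / c * s) := by field_simp
  have e' : d * s' = c * (d / c * s') := by field_simp
  rw [e, e']
  rcases lt_or_gt_of_ne hc with hc | hc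
  · simp only [mul_lt_mul_left_of_neg hc]
    exact ⟨h.2, h.1⟩
  · simp only [mul_lt_mul_iff_right₀ hc]
    exact h

theorem step {A : Type} [Finite A] {k : ℕ} (C : Finset ℚ) (a a' : A → ℚ) (x x' : Fin k → ℚ)
    (h : Agree (enl C) (Sum.elim a x) (Sum.elim a' x')) (y : ℚ) :
    ∃ y', Agree C (Sum.elim a (Fin.snoc x y : Fin (k+1) → ℚ))
      (Sum.elim a' (Fin.snoc x' y' : Fin (k+1) → ℚ)) := by
  obtain ⟨y', hy'⟩ := cut (I := {c // c ∈ enl C} × Option (A ⊕ Fin k))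
    (fun p => p.1.1 * val (Sum.elim a x) p.2) (fun p => p.1.1 * val (Sum.elim a' x') p.2)
    (fun p q => h _ p.1.2 _ q.1.2 _ _) y
  have hy : ∀ c ∈ enl C, ∀ u, (y < c * val (Sum.elim a x) u ↔ y' < c * val (Sum.elim a' x') u) ∧
      (c * val (Sum.elim a x) u < y ↔ c * val (Sum.elim a' x') u < y') :=
    fun c hc u => hy' (⟨c, hc⟩, u)
  have h0 : (0 : ℚ) ∈ enl C := by simp [enl]
  have hC : ∀ c ∈ C, c ∈ enl C := fun c hc => by simp [enl, hc]
  have hdiv : ∀ d ∈ C, ∀ c ∈ C, d / c ∈ enl C := fun d hd c hc => by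
    simp only [enl, Finset.mem_insert, Finset.mem_union, Finset.mem_image, Finset.mem_product]
    exact Or.inr (Or.inr ⟨(d, c), ⟨hd, hc⟩, rfl⟩)
  have hs : (y < 0 ↔ y' < 0) ∧ (0 < y ↔ 0 < y') := by simpa using hy 0 h0 none
  have key : ∀ c ∈ C, ∀ d ∈ C, ∀ u,
      (c * y < d * val (Sum.elim a x) u ↔ c * y' < d * val (Sum.elim a' x') u) ∧
      (d * val (Sum.elim a x) u < c * y ↔ d * val (Sum.elim a' x') u < c * y') := by
    intro c hc d hd u
    by_cases hc0 : c = 0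
    · have h1 := h 0 h0 d (hC d hd) none u
      have h2 := h d (hC d hd) 0 h0 u none
      subst hc0
      simp only [zero_mul] at h1 h2 ⊢
      exact ⟨h1, h2⟩
    · exact cmp_left hc0 (hy _ (hdiv d hd c hc) u)
  refine ⟨y', fun c hc d hd u w => ?_⟩
  rcases val_snoc u with hu | ⟨u', hu⟩ <;> rcases val_snoc w with hw | ⟨w', hw⟩ <;>
    simp only [hu, hw]
  · have e : ∀ z : ℚ, c * z < d * z ↔ 0 < (d - c) * z := fun z => by
      rw [sub_mul, sub_pos]
    rw [e, e, mul_pos_iff, mul_pos_iff, hs.1, hs.2]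
  · exact (key c hc d hd w').1
  · exact (key d hd c hc u').2
  · exact h c (hC c hc) d (hC d hd) u' w'

theorem dep {A : Type} [Finite A] {k : ℕ} (φ : tau0.BoundedFormula A k) :
    ∃ C : Finset ℚ, ∀ (a a' : A → ℚ) (x x' : Fin k → ℚ),
      Agree C (Sum.elim a x) (Sum.elim a' x') → (φ.Realize a x ↔ φ.Realize a' x') := by
  classical
  induction φ with
  | falsum => exact ⟨∅, fun _ _ _ _ _ => Iff.rfl⟩
  | equal t s =>
    obtain ⟨c, u, ht⟩ := term_nf t
    obtain ⟨d, w, hs⟩ := term_nf s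
    refine ⟨{c, d}, fun a a' x x' h => ?_⟩
    have h1 := h c (by simp) d (by simp) u w
    have h2 := h d (by simp) c (by simp) w u
    simp only [BoundedFormula.Realize, ht, hs]
    rw [eq_iff_le_not_lt, eq_iff_le_not_lt, ← not_lt, ← not_lt, h1, h2]
  | @rel m l r ts =>
    match l, r, ts with
    | 2, r, ts =>
      obtain ⟨c, u, ht⟩ := term_nf (ts 0)
      obtain ⟨d, w, hs⟩ := term_nf (ts 1)
      refine ⟨{c, d}, fun a a' x x' h => ?_⟩
      have h1 := h c (by simp) d (by simp) u w
      rw [← ht, ← ht, ← hs, ← hs] at h1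
      exact h1
    | 0, r, _ => exact r.elim
    | 1, r, _ => exact r.elim
    | _ + 3, r, _ => exact r.elim
  | imp f g hf hg =>
    obtain ⟨C, hC⟩ := hf
    obtain ⟨D, hD⟩ := hg
    refine ⟨C ∪ D, fun a a' x x' h => ?_⟩
    simp only [BoundedFormula.realize_imp]
    rw [hC a a' x x' (h.mono Finset.subset_union_left),
      hD a a' x x' (h.mono Finset.subset_union_right)]
  | all f hf =>
    obtain ⟨C, hC⟩ := hf
    have aux : ∀ (a a' : A → ℚ) (x x' : Fin _ → ℚ),
      Agree (enl C) (Sum.elim a x) (Sum.elim a' x') → f.all.Realize a x → f.all.Realize a' x' := by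
      intro a a' x x' h H y
      obtain ⟨y', hy'⟩ := step C a' a x' x h.symm y
      exact (hC _ _ _ _ hy').2 (H y')
    exact ⟨enl C, fun a a' x x' h => ⟨aux _ _ _ _ h, aux _ _ _ _ h.symm⟩⟩

/-- quantifier-free definability -/
def QFD {A : Type} (P : (A → ℚ) → Prop) : Prop :=
  ∃ ψ : tau0.Formula A, BoundedFormula.IsQF ψ ∧ ∀ a : A → ℚ, ψ.Realize a ↔ P a

theorem qfd_of_det {A : Type} {I : Type} (Q : I → (A → ℚ) → Prop) (hQ : ∀ i, QFD (Q i))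
    (S : Finset I) : ∀ P : (A → ℚ) → Prop,
      (∀ a a', (∀ i ∈ S, Q i a ↔ Q i a') → P a → P a') → QFD P := by
  classical
  induction S using Finset.induction_on with
  | empty =>
    intro P hP
    by_cases h : ∃ a, P a
    · obtain ⟨a, ha⟩ := h
      exact ⟨⊤, BoundedFormula.IsQF.top, fun b =>
        ⟨fun _ => hP a b (by simp) ha, fun _ => by simp [Formula.Realize]⟩⟩
    · push Not at h
      exact ⟨⊥, BoundedFormula.isQF_bot, fun b => by simp [Formula.Realize, h b]⟩
  | insert i S _ ih =>
    intro P hP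
    obtain ⟨q, hq, hq'⟩ := hQ i
    obtain ⟨f, hf, hf'⟩ := ih (fun a => ∃ b, Q i b ∧ P b ∧ ∀ j ∈ S, Q j b ↔ Q j a)
      (fun a a' h ⟨b, h1, h2, h3⟩ => ⟨b, h1, h2, fun j hj => (h3 j hj).trans (h j hj)⟩)
    obtain ⟨g, hg, hg'⟩ := ih (fun a => ∃ b, ¬ Q i b ∧ P b ∧ ∀ j ∈ S, Q j b ↔ Q j a)
      (fun a a' h ⟨b, h1, h2, h3⟩ => ⟨b, h1, h2, fun j hj => (h3 j hj).trans (h j hj)⟩)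
    refine ⟨(q ⊓ f) ⊔ (q.not ⊓ g), (hq.inf hf).sup (hq.not.inf hg), fun a => ?_⟩
    have e : Formula.Realize ((q ⊓ f) ⊔ (q.not ⊓ g)) a ↔
        (q.Realize a ∧ f.Realize a) ∨ (¬ q.Realize a ∧ g.Realize a) := by
      rw [Formula.realize_sup, Formula.realize_inf, Formula.realize_inf, Formula.realize_not]
    rw [e, hq', hf', hg']
    constructor
    · rintro (⟨h, b, h1, h2, h3⟩ | ⟨h, b, h1, h2, h3⟩)
      · refine hP b a (fun j hj => ?_) h2
        rcases Finset.mem_insert.1 hj with rfl | hj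
        · simp [h, h1]
        · exact h3 j hj
      · refine hP b a (fun j hj => ?_) h2
        rcases Finset.mem_insert.1 hj with rfl | hj
        · simp [h, h1]
        · exact h3 j hj
    · intro h
      by_cases hi : Q i a
      · exact Or.inl ⟨hi, a, hi, h, fun _ _ => Iff.rfl⟩
      · exact Or.inr ⟨hi, a, hi, h, fun _ _ => Iff.rfl⟩

theorem real_eq {A : Type} (φ : tau0.Formula A) (a : A → ℚ) (x : Fin 0 → ℚ) :
    φ.Realize a ↔ BoundedFormula.Realize φ a x := by
  rw [Formula.Realize, Subsingleton.elim x]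

theorem qfd_atom {A : Type} (c d : ℚ) (u w : Option (A ⊕ Fin 0)) :
    QFD (fun a : A → ℚ => c * val (Sum.elim a default) u < d * val (Sum.elim a default) w) := by
  obtain ⟨t, ht⟩ := exists_term c u
  obtain ⟨s, hs⟩ := exists_term d w
  refine ⟨BoundedFormula.rel (L := tau0) (l := 2) () ![t, s],
    (BoundedFormula.IsAtomic.rel _ _).isQF, fun a => ?_⟩
  rw [real_eq _ a default]
  change _ ↔ c * val (Sum.elim a default) u < d * val (Sum.elim a default) w
  rw [← ht, ← hs]
  exact Iff.rfl

end QEL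

/-- The structure `𝔏` admits quantifier elimination: every first-order
`τ₀`-formula `φ(x₁,…,x_n)` is equivalent over `𝔏` to a quantifier-free
`τ₀`-formula `ψ(x₁,…,x_n)`. -/
theorem qe_for_L (n : ℕ) (φ : tau0.Formula (Fin n)) :
    ∃ ψ : tau0.Formula (Fin n),
      FirstOrder.Language.BoundedFormula.IsQF ψ ∧
        ∀ a : Fin n → ℚ, φ.Realize a ↔ ψ.Realize a := by
  classical
  obtain ⟨C, hC⟩ := QEL.dep φ
  obtain ⟨ψ, h1, h2⟩ := QEL.qfd_of_det
    (I := (ℚ × ℚ) × (Option (Fin n ⊕ Fin 0) × Option (Fin n ⊕ Fin 0)))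
    (fun p a => p.1.1 * QEL.val (Sum.elim a default) p.2.1
      < p.1.2 * QEL.val (Sum.elim a default) p.2.2)
    (fun p => QEL.qfd_atom _ _ _ _) ((C ×ˢ C) ×ˢ Finset.univ) (fun a => φ.Realize a)
    (fun a a' h => by
      rw [QEL.real_eq φ a default, QEL.real_eq φ a' default]
      exact (hC a a' default default (fun c hc d hd u w =>
      h ((c, d), (u, w)) (by simp [hc, hd]))).1)
  exact ⟨ψ, h1, fun a => (h2 a).symm⟩
end

section
/- For every quantifier-free τ₀-formula φ with free variables among x, x₁, …, x_n, there exists a quantifier-free τ₀-formula ψ with free variables among x₁, …, x_n such that for all a₁,…,a_n ∈ ℚ: the formula ∃x φ(x, a₁,…,a_n) holds in 𝔏 if and only if ψ(a₁,…,a_n) holds in 𝔏. -/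
open FirstOrder

namespace QE

open FirstOrder.Language

def Df {n : ℕ} (S : (Fin n → ℚ) → Prop) : Prop :=
  ∃ ψ : tau0.Formula (Fin n), FirstOrder.Language.BoundedFormula.IsQF ψ ∧
    ∀ a : Fin n → ℚ, S a ↔ ψ.Realize a

variable {n : ℕ}

lemma Df.congr {S S' : (Fin n → ℚ) → Prop} (h : Df S) (e : ∀ a, S' a ↔ S a) : Df S' := by
  obtain ⟨ψ, q, h⟩ := h
  exact ⟨ψ, q, fun a => (e a).trans (h a)⟩

lemma Df.false : Df (fun _ : Fin n → ℚ => False) :=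
  ⟨⊥, BoundedFormula.isQF_bot, fun a => by simp [Formula.Realize]⟩

lemma Df.imp {S S' : (Fin n → ℚ) → Prop} (h : Df S) (h' : Df S') : Df (fun a => S a → S' a) := by
  obtain ⟨ψ, q, h⟩ := h
  obtain ⟨ψ', q', h'⟩ := h'
  refine ⟨BoundedFormula.imp ψ ψ', q.imp q', fun a => ?_⟩
  simp only [h, h', Formula.Realize, BoundedFormula.realize_imp]

lemma Df.not {S : (Fin n → ℚ) → Prop} (h : Df S) : Df (fun a => ¬ S a) := h.imp Df.false

lemma Df.and {S S' : (Fin n → ℚ) → Prop} (h : Df S) (h' : Df S') : Df (fun a => S a ∧ S' a) :=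
  (h.imp h'.not).not.congr fun a => by tauto

lemma Df.or {S S' : (Fin n → ℚ) → Prop} (h : Df S) (h' : Df S') : Df (fun a => S a ∨ S' a) :=
  (h.not.imp h').congr fun a => by tauto

lemma Df.const (p : Prop) : Df (fun _ : Fin n → ℚ => p) := by
  by_cases hp : p
  · exact Df.false.not.congr fun a => by simp [hp]
  · exact Df.false.congr fun a => by simp [hp]

lemma Df.ex {ι : Type} [Finite ι] {S : ι → (Fin n → ℚ) → Prop} (h : ∀ i, Df (S i)) :
    Df (fun a => ∃ i, S i a) := by
  classical
  have := Fintype.ofFinite ι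
  have key : ∀ s : Finset ι, Df (fun a => ∃ i ∈ s, S i a) := by
    intro s
    induction s using Finset.induction_on with
    | empty => exact Df.false.congr fun a => by simp
    | insert i s hi ih => exact ((h i).or ih).congr fun a => by simp
  exact (key Finset.univ).congr fun a => by simp

lemma Df.all {ι : Type} [Finite ι] {S : ι → (Fin n → ℚ) → Prop} (h : ∀ i, Df (S i)) :
    Df (fun a => ∀ i, S i a) :=
  (Df.ex fun i => (h i).not).not.congr fun a => by simp

abbrev ltS : tau0.Relations 2 := ()

lemma Df.lt (s t : tau0.Term (Fin n)) :
    Df (fun a : Fin n → ℚ => s.realize a < t.realize a) := by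
  refine ⟨Relations.formula₂ ltS s t, ?_, fun a => ?_⟩
  · exact (BoundedFormula.IsAtomic.rel _ _).isQF
  · simp only [Formula.realize_rel₂]
    rfl

lemma Df.cmpr (s t : tau0.Term (Fin n)) (o : Ordering) :
    Df (fun a : Fin n → ℚ => cmp (s.realize a) (t.realize a) = o) := by
  cases o with
  | lt => exact (Df.lt s t).congr fun a => by simp
  | gt => exact (Df.lt t s).congr fun a => by simp
  | eq =>
    refine ((Df.lt s t).not.and (Df.lt t s).not).congr fun a => ?_
    rw [cmp_eq_eq_iff, not_lt, not_lt, and_comm]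
    exact le_antisymm_iff

def smul (c : ℚ) (t : tau0.Term (Fin n)) : tau0.Term (Fin n) :=
  Functions.apply₁ (L := tau0) (c : tau0.Functions 1) t

lemma realize_smul (c : ℚ) (t : tau0.Term (Fin n)) (a : Fin n → ℚ) :
    (smul c t).realize a = c * t.realize a := by
  simp only [smul, Term.realize_functions_apply₁]
  rfl

def one : tau0.Term (Fin n) := Constants.term (L := tau0) (() : tau0.Functions 0)

lemma term_cases (t : tau0.Term (Fin n ⊕ Fin 1)) :
    (∃ c : ℚ, ∀ (a : Fin n → ℚ) (x : Fin 1 → ℚ), t.realize (Sum.elim a x) = c * x 0) ∨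
    (∃ s : tau0.Term (Fin n), ∀ (a : Fin n → ℚ) (x : Fin 1 → ℚ),
      t.realize (Sum.elim a x) = s.realize a) := by
  induction t with
  | var i =>
    rcases i with i | i
    · exact .inr ⟨.var i, fun a x => rfl⟩
    · refine .inl ⟨1, fun a x => ?_⟩
      rw [Subsingleton.elim i 0]; simp
  | @func l f ts ih =>
    match l, f, ts, ih with
    | 0, f, ts, ih => exact .inr ⟨one, fun a x => rfl⟩
    | 1, c, ts, ih =>
      rcases ih 0 with ⟨d, h⟩ | ⟨s, h⟩
      · refine .inl ⟨(show ℚ from c) * d, fun a x => ?_⟩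
        rw [mul_assoc, ← h a x]; rfl
      · refine .inr ⟨smul c s, fun a x => ?_⟩
        rw [realize_smul, ← h a x]; rfl
    | _ + 2, f, _, _ => exact f.elim

/-- `P x a` is decided by comparing `x` with finitely many terms. -/
def Good (P : ℚ → (Fin n → ℚ) → Prop) : Prop :=
  ∃ T : Finset (tau0.Term (Fin n)), ∀ σ : tau0.Term (Fin n) → Ordering,
    ∃ D, Df D ∧ ∀ a x, (∀ t ∈ T, cmp x (t.realize a) = σ t) → (P x a ↔ D a)

lemma Good.congr {P Q : ℚ → (Fin n → ℚ) → Prop} (h : Good P) (e : ∀ x a, Q x a ↔ P x a) :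
    Good Q := by
  obtain ⟨T, h⟩ := h
  refine ⟨T, fun σ => ?_⟩
  obtain ⟨D, hD, h⟩ := h σ
  exact ⟨D, hD, fun a x hx => (e x a).trans (h a x hx)⟩

lemma Good.of_df {D : (Fin n → ℚ) → Prop} (h : Df D) : Good (fun _ a => D a) :=
  ⟨∅, fun _ => ⟨D, h, fun _ _ _ => Iff.rfl⟩⟩

lemma Good.imp {P Q : ℚ → (Fin n → ℚ) → Prop} (h : Good P) (h' : Good Q) :
    Good (fun x a => P x a → Q x a) := by
  classical
  obtain ⟨T, h⟩ := h
  obtain ⟨T', h'⟩ := h'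
  refine ⟨T ∪ T', fun σ => ?_⟩
  obtain ⟨D, hD, h⟩ := h σ
  obtain ⟨D', hD', h'⟩ := h' σ
  refine ⟨_, hD.imp hD', fun a x hx => ?_⟩
  beta_reduce
  rw [h a x fun t ht => hx t (Finset.mem_union_left _ ht),
    h' a x fun t ht => hx t (Finset.mem_union_right _ ht)]

lemma Good.not {P : ℚ → (Fin n → ℚ) → Prop} (h : Good P) : Good (fun x a => ¬ P x a) :=
  h.imp (Good.of_df Df.false)

lemma Good.and {P Q : ℚ → (Fin n → ℚ) → Prop} (h : Good P) (h' : Good Q) :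
    Good (fun x a => P x a ∧ Q x a) :=
  (h.imp h'.not).not.congr fun a x => by tauto

lemma Good.cmpr (t : tau0.Term (Fin n)) (o : Ordering) :
    Good (fun x a => cmp x (t.realize a) = o) :=
  ⟨{t}, fun σ => ⟨_, Df.const (σ t = o), fun a x hx => by
    beta_reduce; rw [hx t (by simp)]⟩⟩

lemma Good.x_lt (t : tau0.Term (Fin n)) : Good (fun x a => x < t.realize a) :=
  (Good.cmpr t .lt).congr fun a x => by simp

lemma Good.lt_x (t : tau0.Term (Fin n)) : Good (fun x a => t.realize a < x) :=
  (Good.cmpr t .gt).congr fun a x => by simp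

lemma zero_real (a : Fin n → ℚ) : (smul 0 one : tau0.Term (Fin n)).realize a = 0 := by
  rw [realize_smul, zero_mul]

lemma Good.cx_lt (c : ℚ) (t : tau0.Term (Fin n)) : Good (fun x a => c * x < t.realize a) := by
  rcases lt_trichotomy c 0 with h | h | h
  · refine (Good.lt_x (smul c⁻¹ t)).congr fun x a => ?_
    rw [realize_smul, inv_mul_eq_div, div_lt_iff_of_neg h, mul_comm]
  · refine (Good.of_df (Df.lt (smul 0 one) t)).congr fun x a => ?_
    rw [zero_real, h, zero_mul]
  · refine (Good.x_lt (smul c⁻¹ t)).congr fun x a => ?_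
    rw [realize_smul, inv_mul_eq_div, lt_div_iff₀ h, mul_comm]

lemma Good.lt_cx (c : ℚ) (t : tau0.Term (Fin n)) : Good (fun x a => t.realize a < c * x) := by
  refine (Good.cx_lt (-c) (smul (-1) t)).congr fun x a => ?_
  rw [realize_smul]
  constructor <;> intro h <;> linarith

lemma Good.atom (s t : tau0.Term (Fin n ⊕ Fin 1)) :
    Good (fun x a => s.realize (Sum.elim a fun _ => x) < t.realize (Sum.elim a fun _ => x)) := by
  rcases term_cases s with ⟨c, hc⟩ | ⟨s', hs⟩ <;> rcases term_cases t with ⟨d, hd⟩ | ⟨t', ht⟩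
  · refine (Good.cx_lt (c - d) (smul 0 one)).congr fun x a => ?_
    rw [hc, hd, zero_real]
    constructor <;> intro h <;> linarith
  · exact (Good.cx_lt c t').congr fun x a => by rw [hc, ht]
  · exact (Good.lt_cx d s').congr fun x a => by rw [hs, hd]
  · exact (Good.of_df (Df.lt s' t')).congr fun x a => by rw [hs, ht]

lemma Good.of_qf (φ : tau0.BoundedFormula (Fin n) 1) (hφ : φ.IsQF) :
    Good (fun x a => φ.Realize a fun _ => x) := by
  induction hφ with
  | falsum => exact (Good.of_df Df.false).congr fun x a => Iff.rfl
  | imp _ _ ih ih' => exact (ih.imp ih').congr fun x a => Iff.rfl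
  | of_isAtomic h =>
    cases h with
    | equal s t =>
      refine ((Good.atom s t).not.and (Good.atom t s).not).congr fun x a => ?_
      rw [not_lt, not_lt, BoundedFormula.realize_bdEqual, and_comm]
      exact le_antisymm_iff
    | @rel l R ts =>
      match l, R, ts with
      | 2, R, ts => exact (Good.atom (ts 0) (ts 1)).congr fun x a => Iff.rfl
      | 0, R, _ => exact R.elim
      | 1, R, _ => exact R.elim
      | _ + 3, R, _ => exact R.elim

lemma pattern {ι : Type} [Finite ι] (v : ι → ℚ) (σ : ι → Ordering) :
    (∃ x, ∀ i, cmp x (v i) = σ i) ↔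
      (∃ j, ∀ i, cmp (v j) (v i) = σ i) ∨
      ((∀ i, σ i ≠ .eq) ∧ ∀ i j, σ i = .gt → σ j = .lt → v i < v j) := by
  constructor
  · rintro ⟨x, hx⟩
    by_cases h : ∃ j, σ j = .eq
    · obtain ⟨j, hj⟩ := h
      left
      refine ⟨j, ?_⟩
      have := hx j
      rw [hj, cmp_eq_eq_iff] at this
      rw [← this]; exact hx
    · right
      push Not at h
      refine ⟨h, fun i j hi hj => ?_⟩
      have h1 := hx i
      have h2 := hx j
      rw [hi, cmp_eq_gt_iff] at h1
      rw [hj, cmp_eq_lt_iff] at h2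
      exact h1.trans h2
  · rintro (⟨j, hj⟩ | ⟨hne, h⟩)
    · exact ⟨_, hj⟩
    · obtain ⟨x, hx, hx'⟩ := Order.exists_between_finsets
        (Set.toFinite (v '' {i | σ i = .gt})).toFinset (Set.toFinite (v '' {i | σ i = .lt})).toFinset (by
          intro y hy z hz
          rw [Set.Finite.mem_toFinset] at hy hz
          obtain ⟨i, hi, rfl⟩ := hy
          obtain ⟨j, hj, rfl⟩ := hz
          exact h i j hi hj)
      refine ⟨x, fun i => ?_⟩
      cases hi : σ i with
      | lt => exact (cmp_eq_lt_iff _ _).2 (hx' _ ((Set.Finite.mem_toFinset _).2 ⟨i, hi, rfl⟩))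
      | gt => exact (cmp_eq_gt_iff _ _).2 (hx _ ((Set.Finite.mem_toFinset _).2 ⟨i, hi, rfl⟩))
      | eq => exact absurd hi (hne i)

lemma Good.ex {P : ℚ → (Fin n → ℚ) → Prop} (h : Good P) : Df (fun a => ∃ x, P x a) := by
  classical
  obtain ⟨T, h⟩ := h
  have h2 : ∀ σ : T → Ordering, ∃ D : (Fin n → ℚ) → Prop, Df D ∧
      ∀ (a : Fin n → ℚ) (x : ℚ), (∀ t : T, cmp x (t.1.realize a) = σ t) → (P x a ↔ D a) := by
    intro σ
    obtain ⟨D, hD, h⟩ := h fun t => if ht : t ∈ T then σ ⟨t, ht⟩ else .eq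
    refine ⟨D, hD, fun a x hx => h a x fun t ht => ?_⟩
    rw [dif_pos ht]; exact hx ⟨t, ht⟩
  choose D hD hP using h2
  have : Finite Ordering := by
    refine Finite.of_surjective (fun i : Fin 3 => ![Ordering.lt, .eq, .gt] i) fun o => ?_
    cases o
    · exact ⟨0, rfl⟩
    · exact ⟨1, rfl⟩
    · exact ⟨2, rfl⟩
  have key : Df (fun a => ∃ σ : T → Ordering, D σ a ∧
      ∃ x, ∀ t : T, cmp x (t.1.realize a) = σ t) := by
    refine Df.ex fun σ => (hD σ).and ?_
    refine Df.congr ?_ fun a => pattern (fun t : T => t.1.realize a) σ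
    refine (Df.ex fun j => Df.all fun i => Df.cmpr _ _ _).or ((Df.const _).and ?_)
    exact Df.all fun i => Df.all fun j => (Df.const _).imp ((Df.const _).imp (Df.lt _ _))
  refine key.congr fun a => ⟨?_, ?_⟩
  · rintro ⟨x, hx⟩
    exact ⟨fun t => cmp x (t.1.realize a), (hP _ a x fun t => rfl).1 hx, x, fun t => rfl⟩
  · rintro ⟨σ, hd, x, hx⟩
    exact ⟨x, (hP σ a x hx).2 hd⟩

end QE

/-- One-step quantifier elimination for `𝔏`: for every quantifier-free
`τ₀`-formula `φ` with free variables among `x, x₁, …, x_n` (the extra variable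
`x` being the single bound variable), there is a quantifier-free `τ₀`-formula
`ψ` with free variables among `x₁, …, x_n` such that `∃x. φ` and `ψ` are
equivalent over `𝔏`. -/
theorem qe_ex_step (n : ℕ) (φ : tau0.BoundedFormula (Fin n) 1)
    (hφ : φ.IsQF) :
    ∃ ψ : tau0.Formula (Fin n),
      FirstOrder.Language.BoundedFormula.IsQF ψ ∧
        ∀ a : Fin n → ℚ, φ.ex.Realize a (default : Fin 0 → ℚ) ↔ ψ.Realize a := by
  obtain ⟨ψ, q, h⟩ := (QE.Good.of_qf φ hφ).ex
  refine ⟨ψ, q, fun a => Iff.trans ?_ (h a)⟩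
  rw [FirstOrder.Language.BoundedFormula.realize_ex]
  refine exists_congr fun x => ?_
  have : (Fin.snoc (default : Fin 0 → ℚ) x : Fin 1 → ℚ) = fun _ => x := by
    funext i
    have hi : i = Fin.last 0 := Subsingleton.elim (α := Fin 1) _ _
    rw [hi]
    exact Fin.snoc_last (α := fun _ => ℚ) _ _
  rw [this]
end

section
/- For every first-order τ₀-formula φ(x₁,…,x_n): there exist a₁,…,a_n ∈ ℚ satisfying φ in 𝔏 if and only if there exist b₁,…,b_n ∈ ℚ ×ₗₑₓ ℚ satisfying φ in 𝔏^⋆. (In particular, 𝔏 and the τ₀-reduct of 𝔏^⋆ satisfy the same τ₀-sentences.) -/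
open FirstOrder

/-- The structure `𝔏⋆`: domain `ℚ ×ₗₑₓ ℚ` (with componentwise addition and
rational scalar multiplication and the lexicographic order), `<` the
lexicographic order, `1` the element `(1,0)`, and `c·` componentwise scalar
multiplication. -/
instance lexL : tau0.Structure (ℚ ×ₗ ℚ) where
  funMap := fun {n} f x =>
    match n, f, x with
    | 0, _, _ => toLex ((1 : ℚ), (0 : ℚ))
    | 1, c, x => toLex (c * (ofLex (x 0)).1, c * (ofLex (x 0)).2)
    | _ + 2, f, _ => f.elim
  RelMap := fun {n} r x =>
    match n, r, x with
    | 2, _, x => x 0 < x 1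
    | 0, r, _ => r.elim
    | 1, r, _ => r.elim
    | _ + 3, r, _ => r.elim

namespace LProof

theorem rsmul_pos {K : Type} [AddCommGroup K] [LinearOrder K] [IsOrderedAddMonoid K] [Module ℚ K]
    {c : ℚ} {d : K} (hc : 0 < c) (hd : 0 < d) : 0 < c • d := by
  by_contra h
  have h1 : c.den • (c • d) ≤ 0 := nsmul_nonpos (not_lt.1 h) _
  have h2 : c.den • (c • d) = c.num.toNat • d := by
    rw [← Nat.cast_smul_eq_nsmul ℚ, smul_smul, ← Nat.cast_smul_eq_nsmul ℚ]
    congr 1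
    have e : ((c.num.toNat : ℤ) : ℚ) = (c.num : ℚ) := by
      rw [Int.toNat_of_nonneg (Rat.num_pos.2 hc).le]
    rw [mul_comm, Rat.mul_den_eq_num, ← e, Int.cast_natCast]
  rw [h2] at h1
  refine absurd (nsmul_pos hd ?_) (not_lt.2 h1)
  have := Rat.num_pos.2 hc
  omega

theorem rsmul_neg {K : Type} [AddCommGroup K] [LinearOrder K] [IsOrderedAddMonoid K] [Module ℚ K]
    {c : ℚ} {d : K} (hc : 0 < c) (hd : d < 0) : c • d < 0 := by
  have := rsmul_pos hc (neg_pos.2 hd)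
  rwa [smul_neg, neg_pos] at this

class Good (M : Type) [AddCommGroup M] [LinearOrder M] [IsOrderedAddMonoid M] [Module ℚ M]
    [tau0.Structure M] where
  one : M
  one_pos : 0 < one
  hone : ∀ (f : tau0.Functions 0) (x : Fin 0 → M), Language.Structure.funMap f x = one
  hsmul : ∀ (c : ℚ) (x : Fin 1 → M),
    Language.Structure.funMap (show tau0.Functions 1 from c) x = c • x 0
  hlt : ∀ (r : tau0.Relations 2) (x : Fin 2 → M), Language.Structure.RelMap r x ↔ x 0 < x 1

section
variable {M : Type} [AddCommGroup M] [LinearOrder M] [IsOrderedAddMonoid M] [Module ℚ M]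
    [tau0.Structure M] [Good M]
variable {N : Type} [AddCommGroup N] [LinearOrder N] [IsOrderedAddMonoid N] [Module ℚ N]
    [tau0.Structure N] [Good N]

abbrev Form (n : ℕ) := ℚ × (Fin n → ℚ)

def ev {n : ℕ} (w : Form n) (x : Fin n → M) : M := w.1 • Good.one + ∑ i, w.2 i • x i

def rest {n : ℕ} (w : Form (n+1)) : Form n := (w.1, fun i => w.2 i.castSucc)

def root {n : ℕ} (w : Form (n+1)) : Form n := (-(w.2 (Fin.last n))⁻¹) • rest w

theorem ev_sub {n : ℕ} (u v : Form n) (x : Fin n → M) : ev (u - v) x = ev u x - ev v x := by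
  simp [ev, sub_smul, Finset.sum_sub_distrib]; abel

theorem ev_smul {n : ℕ} (c : ℚ) (v : Form n) (x : Fin n → M) : ev (c • v) x = c • ev v x := by
  simp [ev, mul_smul, Finset.smul_sum]

theorem ev_snoc {n : ℕ} (w : Form (n+1)) (x : Fin n → M) (y : M) :
    ev w (Fin.snoc x y : Fin (n+1) → M) = ev (rest w) x + w.2 (Fin.last n) • y := by
  simp [ev, rest, Fin.sum_univ_castSucc, add_assoc]

theorem ev_snoc' {n : ℕ} (w : Form (n+1)) (x : Fin n → M) (y : M) (h : w.2 (Fin.last n) ≠ 0) :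
    ev w (Fin.snoc x y : Fin (n+1) → M) = (-w.2 (Fin.last n)) • (ev (root w) x - y) := by
  rw [ev_snoc, root, ev_smul, smul_sub, smul_smul]
  simp [h]

theorem cmp_sub' (a b : M) : cmp (a - b) 0 = cmp a b := by
  have := cmp_add_right a b (-b)
  simpa [sub_eq_add_neg] using this

theorem cmp_smul_congr (c : ℚ) (d : M) (e : N) (h : cmp d 0 = cmp e 0) :
    cmp (c • d) 0 = cmp (c • e) 0 := by
  rcases lt_trichotomy c 0 with hc | rfl | hc
  · have key : ∀ {K : Type} [AddCommGroup K] [LinearOrder K] [IsOrderedAddMonoid K] [Module ℚ K]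
        (d : K), cmp (c • d) 0 = cmp 0 d := by
      intro K _ _ _ _ d
      rcases lt_trichotomy d 0 with h | rfl | h
      · rw [(cmp_eq_gt_iff _ _).2 h, (cmp_eq_gt_iff _ _).2 (by simpa using rsmul_neg (neg_pos.2 hc) h)]
      · simp
      · rw [(cmp_eq_lt_iff _ _).2 h, (cmp_eq_lt_iff _ _).2 (by simpa using rsmul_pos (neg_pos.2 hc) h)]
    rw [key, key, ← cmp_swap, h, cmp_swap]
  · simp
  · have key : ∀ {K : Type} [AddCommGroup K] [LinearOrder K] [IsOrderedAddMonoid K] [Module ℚ K]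
        (d : K), cmp (c • d) 0 = cmp d 0 := by
      intro K _ _ _ _ d
      rcases lt_trichotomy d 0 with h | rfl | h
      · rw [(cmp_eq_lt_iff _ _).2 h, (cmp_eq_lt_iff _ _).2 (rsmul_neg hc h)]
      · simp
      · rw [(cmp_eq_gt_iff _ _).2 h, (cmp_eq_gt_iff _ _).2 (rsmul_pos hc h)]
    rw [key, key, h]

def Agree {n : ℕ} (F : Finset (Form n)) (a : Fin n → M) (b : Fin n → N) : Prop :=
  ∀ w ∈ F, cmp (ev w a) 0 = cmp (ev w b) 0

theorem Agree.symm {n : ℕ} {F : Finset (Form n)} {a : Fin n → M} {b : Fin n → N}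
    (h : Agree F a b) : Agree F b a := fun w hw => (h w hw).symm

theorem dense (N : Type) [AddCommGroup N] [LinearOrder N] [IsOrderedAddMonoid N] [Module ℚ N] :
    DenselyOrdered N := by
  refine ⟨fun a b h => ⟨a + (1/2 : ℚ) • (b - a), ?_, ?_⟩⟩
  · have : 0 < (1/2 : ℚ) • (b - a) := rsmul_pos (by norm_num) (sub_pos.2 h)
    simpa using this
  · have : 0 < (1/2 : ℚ) • (b - a) := rsmul_pos (by norm_num) (sub_pos.2 h)
    have e : b = a + (1/2 : ℚ) • (b - a) + (1/2 : ℚ) • (b - a) := by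
      rw [add_assoc, ← add_smul]; norm_num
    calc _ < a + (1/2 : ℚ) • (b - a) + (1/2 : ℚ) • (b - a) := lt_add_of_pos_right _ this
      _ = b := e.symm

def proj {n : ℕ} (F : Finset (Form (n+1))) : Finset (Form n) :=
  F.image rest ∪ Finset.image₂ (fun u v => root u - root v) F F

theorem extend {n : ℕ} (F : Finset (Form (n+1))) (a : Fin n → M) (b : Fin n → N)
    (h : Agree (proj F) a b) (y : M) :
    ∃ z : N, Agree F (Fin.snoc a y : Fin (n+1) → M) (Fin.snoc b z : Fin (n+1) → N) := by
  classical
  have := dense N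
  have : Nontrivial N := ⟨⟨Good.one, 0, (Good.one_pos (M := N)).ne'⟩⟩
  let f : Order.PartialIso M N := ⟨F.image (fun w => (ev (root w) a, ev (root w) b)), by
    intro p hp q hq
    obtain ⟨u, hu, rfl⟩ := Finset.mem_image.1 hp
    obtain ⟨v, hv, rfl⟩ := Finset.mem_image.1 hq
    have := h (root u - root v) (Finset.mem_union_right _ (Finset.mem_image₂_of_mem hu hv))
    simpa [ev_sub, cmp_sub'] using this⟩
  obtain ⟨z, hz⟩ := f.exists_across y
  refine ⟨z, fun w hw => ?_⟩
  by_cases hc : w.2 (Fin.last n) = 0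
  · rw [ev_snoc, ev_snoc, hc]
    simpa using h (rest w) (Finset.mem_union_left _ (Finset.mem_image_of_mem _ hw))
  · rw [ev_snoc' _ _ _ hc, ev_snoc' _ _ _ hc]
    apply cmp_smul_congr
    rw [cmp_sub', cmp_sub']
    exact hz _ (Finset.mem_image_of_mem _ hw)

end

theorem term_form {n : ℕ} (t : tau0.Term (Empty ⊕ Fin n)) : ∃ w : Form n,
    ∀ (M : Type) [AddCommGroup M] [LinearOrder M] [IsOrderedAddMonoid M] [Module ℚ M]
    [tau0.Structure M] [Good M] (e : Empty → M) (x : Fin n → M),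
    t.realize (Sum.elim e x) = ev w x := by
  induction t with
  | var v =>
    rcases v with v | i
    · exact v.elim
    · refine ⟨(0, Pi.single i 1), ?_⟩
      intros
      simp [ev, Pi.single_apply, ite_smul]
  | @func l f ts ih =>
    match l, f, ts, ih with
    | 0, f, ts, ih =>
      refine ⟨(1, 0), ?_⟩
      intros
      simp only [Language.Term.realize_func, Good.hone]
      simp [ev]
    | 1, f, ts, ih =>
      obtain ⟨w, hw⟩ := ih 0
      refine ⟨(show ℚ from f) • w, ?_⟩
      intro M _ _ _ _ _ _ e x
      rw [ev_smul, ← hw M e x]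
      exact Good.hsmul _ _
    | _ + 2, f, _, _ => exact f.elim

theorem formula_forms {n : ℕ} (φ : tau0.BoundedFormula Empty n) : ∃ F : Finset (Form n),
    ∀ (M : Type) [AddCommGroup M] [LinearOrder M] [IsOrderedAddMonoid M] [Module ℚ M]
    [tau0.Structure M] [Good M]
    (N : Type) [AddCommGroup N] [LinearOrder N] [IsOrderedAddMonoid N] [Module ℚ N]
    [tau0.Structure N] [Good N] (e : Empty → M) (e' : Empty → N) (a : Fin n → M) (b : Fin n → N),
    Agree F a b → (φ.Realize e a ↔ φ.Realize e' b) := by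
  classical
  induction φ with
  | falsum => exact ⟨∅, by intros; rfl⟩
  | equal s t =>
    obtain ⟨u, hu⟩ := term_form s
    obtain ⟨v, hv⟩ := term_form t
    refine ⟨{u - v}, ?_⟩
    intro M _ _ _ _ _ _ N _ _ _ _ _ _ e e' a b h
    have h := h _ (Finset.mem_singleton_self _)
    rw [ev_sub, ev_sub, cmp_sub', cmp_sub'] at h
    simp only [Language.BoundedFormula.Realize, hu, hv]
    rw [← cmp_eq_eq_iff (ev u a), ← cmp_eq_eq_iff (ev u b), h]
  | @rel n l r ts =>
    match l, r, ts with
    | 2, r, ts =>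
      obtain ⟨u, hu⟩ := term_form (ts 0)
      obtain ⟨v, hv⟩ := term_form (ts 1)
      refine ⟨{u - v}, ?_⟩
      intro M _ _ _ _ _ _ N _ _ _ _ _ _ e e' a b h
      have h := h _ (Finset.mem_singleton_self _)
      rw [ev_sub, ev_sub, cmp_sub', cmp_sub'] at h
      simp only [Language.BoundedFormula.Realize, Good.hlt, hu, hv]
      rw [← cmp_eq_lt_iff, ← cmp_eq_lt_iff, h]
    | 0, r, _ => exact r.elim
    | 1, r, _ => exact r.elim
    | _ + 3, r, _ => exact r.elim
  | imp f g ihf ihg =>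
    obtain ⟨F, hF⟩ := ihf
    obtain ⟨G, hG⟩ := ihg
    refine ⟨F ∪ G, ?_⟩
    intro M _ _ _ _ _ _ N _ _ _ _ _ _ e e' a b h
    have h1 := hF M N e e' a b fun w hw => h w (Finset.mem_union_left _ hw)
    have h2 := hG M N e e' a b fun w hw => h w (Finset.mem_union_right _ hw)
    simp only [Language.BoundedFormula.realize_imp, h1, h2]
  | all f ih =>
    obtain ⟨F, hF⟩ := ih
    refine ⟨proj F, ?_⟩
    intro M _ _ _ _ _ _ N _ _ _ _ _ _ e e' a b h
    simp only [Language.BoundedFormula.realize_all]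
    constructor
    · intro H z
      obtain ⟨y, hy⟩ := extend F b a h.symm z
      exact (hF M N e e' _ _ hy.symm).1 (H y)
    · intro H y
      obtain ⟨z, hz⟩ := extend F a b h y
      exact (hF M N e e' _ _ hz).2 (H z)

theorem transfer (φ : tau0.Sentence)
    (M : Type) [AddCommGroup M] [LinearOrder M] [IsOrderedAddMonoid M] [Module ℚ M]
    [tau0.Structure M] [Good M]
    (N : Type) [AddCommGroup N] [LinearOrder N] [IsOrderedAddMonoid N] [Module ℚ N]
    [tau0.Structure N] [Good N] (e : Empty → M) (e' : Empty → N) :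
    Language.Formula.Realize φ e ↔ Language.Formula.Realize φ e' := by
  obtain ⟨F, hF⟩ := formula_forms φ
  refine hF M N e e' _ _ fun w _ => ?_
  simp only [ev, Finset.univ_eq_empty, Finset.sum_empty, add_zero]
  apply cmp_smul_congr
  rw [(cmp_eq_gt_iff _ _).2 Good.one_pos, (cmp_eq_gt_iff _ _).2 Good.one_pos]

instance goodQ : Good ℚ where
  one := 1
  one_pos := one_pos
  hone _ _ := rfl
  hsmul _ _ := rfl
  hlt _ _ := Iff.rfl

instance goodLex : Good (ℚ ×ₗ ℚ) where
  one := toLex (1, 0)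
  one_pos := by
    rw [Prod.Lex.lt_iff]; left; exact one_pos
  hone _ _ := rfl
  hsmul _ _ := rfl
  hlt _ _ := Iff.rfl

end LProof

/-- For every first-order `τ₀`-formula `φ(x₁,…,x_n)`: there exist
`a₁,…,a_n ∈ ℚ` satisfying `φ` in `𝔏` if and only if there exist
`b₁,…,b_n ∈ ℚ ×ₗₑₓ ℚ` satisfying `φ` in `𝔏⋆`. -/
theorem satisfiable_L_iff_Lstar (n : ℕ) (φ : tau0.Formula (Fin n)) :
    (∃ a : Fin n → ℚ, φ.Realize a) ↔ (∃ b : Fin n → ℚ ×ₗ ℚ, φ.Realize b) := by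
  have h := LProof.transfer
    (Language.Formula.iExs (Fin n) (φ.relabel (Sum.inr : Fin n → Empty ⊕ Fin n)))
    ℚ (ℚ ×ₗ ℚ) Empty.elim Empty.elim
  rw [Language.Formula.realize_iExs, Language.Formula.realize_iExs] at h
  simpa [Language.Formula.realize_relabel] using h
end

section
/- Let d ≥ 1 and let Φ be a finite set of atomic τ₀-constraints over variables v₁,…,v_d. If the closure of Φ has a simultaneous solution (x₁,…,x_d) ∈ ℚ^d with x_i > 0 for all i, then the closure of Φ has a simultaneous solution with all values in the set C_{Φ,d}. -/
/-- An atomic `τ₀`-constraint over variables `v₁,…,v_d`: one of the forms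
`c₁·v_i σ c₂·v_j`, `c·v_i σ k`, or `k σ c·v_i`, where `σ ∈ {<,=}` is encoded by
the Boolean `strict` (`true` for `<`, `false` for `=`). -/
inductive Atom (d : ℕ) : Type
  | vv (c₁ c₂ : ℚ) (i j : Fin d) (strict : Bool)
  | vk (c k : ℚ) (i : Fin d) (strict : Bool)
  | kv (k c : ℚ) (i : Fin d) (strict : Bool)
  deriving DecidableEq

/-- Well-formedness: the coefficients are nonzero and, in two-variable
constraints, not both negative. -/
def Atom.WellFormed {d : ℕ} : Atom d → Prop
  | .vv c₁ c₂ _ _ _ => c₁ ≠ 0 ∧ c₂ ≠ 0 ∧ ¬(c₁ < 0 ∧ c₂ < 0)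
  | .vk c _ _ _ => c ≠ 0
  | .kv _ c _ _ => c ≠ 0

/-- Satisfaction of an atomic constraint in `ℚ` under the assignment `x`,
where the strict symbol `<` is interpreted by the relation `lt` (take
`(· < ·)` for the constraint itself, and `(· ≤ ·)` for its closure). -/
def Atom.Holds {d : ℕ} (lt : ℚ → ℚ → Prop) (x : Fin d → ℚ) : Atom d → Prop
  | .vv c₁ c₂ i j s => if s then lt (c₁ * x i) (c₂ * x j) else c₁ * x i = c₂ * x j
  | .vk c k i s => if s then lt (c * x i) k else c * x i = k
  | .kv k c i s => if s then lt k (c * x i) else k = c * x i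

/-- `H(Φ) := {c₁/c₂ : some constraint c₁·v_i σ c₂·v_j is in Φ}`. -/
def Hset {d : ℕ} (Φ : Finset (Atom d)) : Set ℚ :=
  { h | ∃ c₁ c₂ i j s, Atom.vv c₁ c₂ i j s ∈ Φ ∧ h = c₁ / c₂ }

/-- `K(Φ) := {k/c : some constraint c·v_i σ k or k σ c·v_i is in Φ}`. -/
def Kset {d : ℕ} (Φ : Finset (Atom d)) : Set ℚ :=
  { q | ∃ c k i s, (Atom.vk c k i s ∈ Φ ∨ Atom.kv k c i s ∈ Φ) ∧ q = k / c }

/-- `C_{Φ,d} := { |k|·∏_{r=1}^s |h_r|^{e_r} : k ∈ K(Φ) ∪ {1}, e ∈ ℤ^s,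
Σ_r |e_r| < d }`, where `h₁,…,h_s` is an enumeration of `H(Φ)`. -/
def Cset {d : ℕ} (Φ : Finset (Atom d)) : Set ℚ :=
  { x | ∃ k : ℚ, (k ∈ Kset Φ ∨ k = 1) ∧
      ∃ (s : ℕ) (h : Fin s → ℚ) (e : Fin s → ℤ),
        Function.Injective h ∧ (∀ q, q ∈ Hset Φ ↔ ∃ r, h r = q) ∧
        (∑ r, (e r).natAbs) < d ∧
        x = |k| * ∏ r, |h r| ^ (e r) }


lemma pick_t (F : Finset ℚ) (hne : F.Nonempty) (h1 : (1:ℚ) ∉ F) :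
    ∃ t ∈ F, ∀ r ∈ F, (1 < r → t ≤ r) ∧ (r < 1 → r ≤ t) := by
  by_cases h : (F.filter (fun r => 1 < r)).Nonempty
  · obtain ⟨t, ht, hmin⟩ := Finset.exists_min_image _ id h
    simp only [Finset.mem_filter, id] at ht hmin
    refine ⟨t, ht.1, fun r hr => ⟨fun h => hmin r ⟨hr, h⟩, fun h => by linarith [ht.2]⟩⟩
  · obtain ⟨t, ht, hmax⟩ := Finset.exists_max_image F id hne
    refine ⟨t, ht, fun r hr => ⟨fun h' => (h ⟨r, by simp [hr, h']⟩).elim, fun _ => hmax r hr⟩⟩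

def tightG {V : Type*} (W : V → V → Finset ℚ) (x : V → ℚ) : SimpleGraph V :=
  SimpleGraph.fromRel (fun u v => ∃ h ∈ W u v, h * x u = x v)

open Classical in
lemma scale_step {V : Type*} [Fintype V] (o : V) (W : V → V → Finset ℚ)
    (hpos : ∀ u v, ∀ h ∈ W u v, 0 < h) (hinv : ∀ u v, ∀ h ∈ W u v, h⁻¹ ∈ W v u)
    (hne : ∀ v, v ≠ o → (W v o).Nonempty) (x : V → ℚ) (hx : ∀ v, 0 < x v)
    (w : V) (hw : ¬ (tightG W x).Reachable o w) :
    ∃ y : V → ℚ, (∀ v, 0 < y v) ∧ y o = x o ∧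
      (∀ u v, ∀ h ∈ W u v, h * x u ≤ x v → h * y u ≤ y v) ∧
      ∃ u, ¬ (tightG W x).Reachable o u ∧ (tightG W y).Reachable o u ∧ 
        (∀ v, (tightG W x).Reachable o v → (tightG W y).Reachable o v) := by
  set R : V → Prop := fun v => (tightG W x).Reachable o v with hR
  have hRo : R o := SimpleGraph.Reachable.refl _
  set F : Finset ℚ := Finset.univ.biUnion (fun p : V × V => 
    if ¬ R p.1 ∧ R p.2 then (W p.1 p.2).image (fun h => x p.2 / (h * x p.1)) else ∅) with hF
  have memF : ∀ r, r ∈ F ↔ ∃ u v, (¬ R u ∧ R v) ∧ ∃ h ∈ W u v, x v / (h * x u) = r := by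
    intro r
    simp only [hF, Finset.mem_biUnion, Finset.mem_univ, true_and, Prod.exists]
    refine exists_congr fun u => exists_congr fun v => ?_
    by_cases hc : ¬ R u ∧ R v
    · rw [if_pos hc]; simp only [Finset.mem_image]; tauto
    · rw [if_neg hc]; simp [hc]
  have adjR : ∀ u v, ∀ h ∈ W u v, h * x u = x v → R v → R u := by
    intro u v h hh he hv
    by_cases huv : u = v
    · rwa [huv]
    · refine SimpleGraph.Reachable.trans hv (SimpleGraph.Adj.reachable ?_)
      rw [tightG, SimpleGraph.fromRel_adj]
      exact ⟨fun h => huv h.symm, Or.inr ⟨h, hh, he⟩⟩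
  have h1 : (1:ℚ) ∉ F := by
    rw [memF]
    rintro ⟨u, v, ⟨hu, hv⟩, h, hh, he⟩
    have := hx u
    have := hpos u v h hh
    rw [div_eq_one_iff_eq (by positivity)] at he
    exact hu (adjR u v h hh he.symm hv)
  have hFne : F.Nonempty := by
    have hwo : w ≠ o := by rintro rfl; exact hw hRo
    obtain ⟨h, hh⟩ := hne w hwo
    exact ⟨_, (memF _).2 ⟨w, o, ⟨hw, hRo⟩, h, hh, rfl⟩⟩
  obtain ⟨t, htF, ht⟩ := pick_t F hFne h1
  obtain ⟨u₀, v₀, ⟨hu₀, hv₀⟩, h₀, hh₀, rfl⟩ := (memF t).1 htF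
  set t := x v₀ / (h₀ * x u₀) with htdef
  have htpos : 0 < t := div_pos (hx _) (mul_pos (hpos _ _ _ hh₀) (hx _))
  set y : V → ℚ := fun v => if R v then x v else t * x v with hy
  have yR : ∀ v, R v → y v = x v := fun v hv => by simp [hy, hv]
  have yS : ∀ v, ¬ R v → y v = t * x v := fun v hv => by simp [hy, hv]
  have hQ : ∀ u v, ∀ h ∈ W u v, h * x u ≤ x v → h * y u ≤ y v := by
    intro u v h hh hle
    have hhp := hpos _ _ _ hh
    by_cases hu : R u <;> by_cases hv : R v
    · rwa [yR u hu, yR v hv]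
    · rw [yR u hu, yS v hv]
      have hm : x u / (h⁻¹ * x v) ∈ F := (memF _).2 ⟨v, u, ⟨hv, hu⟩, h⁻¹, hinv _ _ _ hh, rfl⟩
      have e : x u / (h⁻¹ * x v) = h * x u / x v := by
        have := (hx v).ne'
        field_simp
      rw [e] at hm
      have hle1 : h * x u / x v ≤ 1 := (div_le_one (hx v)).2 hle
      have hne1 : h * x u / x v ≠ 1 := fun h' => h1 (h' ▸ hm)
      exact (div_le_iff₀ (hx v)).1 ((ht _ hm).2 (lt_of_le_of_ne hle1 hne1))
    · rw [yS u hu, yR v hv]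
      have hm : x v / (h * x u) ∈ F := (memF _).2 ⟨u, v, ⟨hu, hv⟩, h, hh, rfl⟩
      have hp : 0 < h * x u := mul_pos hhp (hx u)
      have hle1 : 1 ≤ x v / (h * x u) := (one_le_div hp).2 hle
      have hne1 : 1 ≠ x v / (h * x u) := fun h' => h1 (h' ▸ hm)
      have := (le_div_iff₀ hp).1 ((ht _ hm).1 (lt_of_le_of_ne hle1 hne1))
      linarith
    · rw [yS u hu, yS v hv]
      have := mul_le_mul_of_nonneg_left hle htpos.le
      linarith
  have hT : ∀ u v, ∀ h ∈ W u v, h * x u = x v → h * y u = y v := by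
    intro u v h hh he
    have hhp := hpos _ _ _ hh
    refine le_antisymm (hQ u v h hh he.le) ?_
    have := hQ v u h⁻¹ (hinv _ _ _ hh) (by rw [← he]; field_simp; exact le_rfl)
    rwa [inv_mul_le_iff₀ hhp] at this
  have hmono : tightG W x ≤ tightG W y := by
    intro u v
    simp only [tightG, SimpleGraph.fromRel_adj]
    rintro ⟨huv, ⟨h, hh, he⟩ | ⟨h, hh, he⟩⟩
    · exact ⟨huv, Or.inl ⟨h, hh, hT _ _ _ hh he⟩⟩
    · exact ⟨huv, Or.inr ⟨h, hh, hT _ _ _ hh he⟩⟩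
  refine ⟨y, ?_, yR o hRo, hQ, u₀, hu₀, ?_, fun v hv => hv.mono hmono⟩
  · intro v
    by_cases hv : R v
    · rw [yR v hv]; exact hx v
    · rw [yS v hv]; exact mul_pos htpos (hx v)
  · refine SimpleGraph.Reachable.trans (SimpleGraph.Reachable.mono hmono hv₀) 
      (SimpleGraph.Adj.reachable ?_)
    rw [tightG, SimpleGraph.fromRel_adj]
    refine ⟨fun h => hu₀ (h ▸ hv₀), Or.inr ⟨h₀, hh₀, ?_⟩⟩
    rw [yS _ hu₀, yR _ hv₀, htdef]
    have := (hx u₀).ne'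
    have := (hpos _ _ _ hh₀).ne'
    field_simp

open Classical in
lemma core {V : Type*} [Fintype V] (o : V) (W : V → V → Finset ℚ)
    (hpos : ∀ u v, ∀ h ∈ W u v, 0 < h) (hinv : ∀ u v, ∀ h ∈ W u v, h⁻¹ ∈ W v u)
    (hne : ∀ v, v ≠ o → (W v o).Nonempty) (n : ℕ) : ∀ (x : V → ℚ), (∀ v, 0 < x v) →
    (Finset.univ.filter (fun v => ¬ (tightG W x).Reachable o v)).card = n →
    ∃ y : V → ℚ, (∀ v, 0 < y v) ∧ y o = x o ∧
      (∀ u v, ∀ h ∈ W u v, h * x u ≤ x v → h * y u ≤ y v) ∧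
      ∀ v, (tightG W y).Reachable o v := by
  induction n using Nat.strong_induction_on with
  | _ n ih =>
    intro x hx hn
    by_cases hall : ∀ v, (tightG W x).Reachable o v
    · exact ⟨x, hx, rfl, fun _ _ _ _ h => h, hall⟩
    · push Not at hall
      obtain ⟨w, hw⟩ := hall
      obtain ⟨y, hy, hyo, hQ, u, hu, hu', hm⟩ := scale_step o W hpos hinv hne x hx w hw
      obtain ⟨z, hz, hzo, hQ', hall⟩ := ih _ (by
        rw [← hn]
        apply Finset.card_lt_card
        rw [Finset.ssubset_iff_of_subset]
        · exact ⟨u, by simp [hu], by simp [hu']⟩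
        · intro v
          simp only [Finset.mem_filter, Finset.mem_univ, true_and]
          exact fun h h' => h (hm v h')) y hy rfl
      exact ⟨z, hz, hzo.trans hyo, fun a b h hh hle => hQ' a b h hh (hQ a b h hh hle), hall⟩

lemma Hset_finite {d : ℕ} (Φ : Finset (Atom d)) : (Hset Φ).Finite := by
  refine (Φ.finite_toSet.image (fun a => match a with
    | .vv c₁ c₂ _ _ _ => c₁ / c₂ | .vk _ _ _ _ => 0 | .kv _ _ _ _ => 0)).subset ?_
  rintro q ⟨c₁, c₂, i, j, s, hm, rfl⟩
  exact ⟨_, hm, rfl⟩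

lemma Kset_finite {d : ℕ} (Φ : Finset (Atom d)) : (Kset Φ).Finite := by
  refine (Φ.finite_toSet.image (fun a => match a with
    | .vv _ _ _ _ _ => 0 | .vk c k _ _ => k / c | .kv k c _ _ => k / c)).subset ?_
  rintro q ⟨c, k, i, s, hm | hm, rfl⟩
  · exact ⟨_, hm, rfl⟩
  · exact ⟨_, hm, rfl⟩

def WW {d : ℕ} (A B : Finset ℚ) : Option (Fin d) → Option (Fin d) → Finset ℚ
  | some _, some _ => A ∪ A.image (·⁻¹)
  | none, some _ => B
  | some _, none => B.image (·⁻¹)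
  | none, none => ∅

lemma walk_mono {d s : ℕ} (A B : Finset ℚ) (h : Fin s → ℚ) (hA : ∀ q ∈ A, ∃ r, |h r| = q)
    (hApos : ∀ q ∈ A, 0 < q) (hBpos : ∀ q ∈ B, 0 < q)
    (y : Option (Fin d) → ℚ) (hy : y none = 1) (u v : Option (Fin d))
    (p : (tightG (WW A B) y).Walk u v) (hv : v = none) : ∀ i, u = some i → 
    ∃ b ∈ B, ∃ e : Fin s → ℤ, (∑ r, (e r).natAbs) + 1 ≤ p.length ∧
      y (some i) = b * ∏ r, |h r| ^ (e r) := by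
  induction p with
  | nil => rintro i rfl; cases hv
  | @cons u w v hadj p ih =>
    rintro i rfl
    rw [tightG, SimpleGraph.fromRel_adj] at hadj
    obtain ⟨-, hadj⟩ := hadj
    cases w with
    | none =>
      simp only [WW, hy, Finset.mem_image] at hadj
      obtain ⟨_, ⟨b, hb, rfl⟩, he⟩ | ⟨b, hb, he⟩ := hadj
      · refine ⟨b, hb, 0, by simp, ?_⟩
        have := hBpos b hb
        field_simp at he
        simp [he]
      · exact ⟨b, hb, 0, by simp, by simp [← he]⟩
    | some j =>
      obtain ⟨b, hb, e, hlen, hj⟩ := ih hv j rfl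
      have key : ∃ r, 0 < |h r| ∧ ∃ ε : ℤ, ε.natAbs = 1 ∧ y (some i) = |h r| ^ ε * y (some j) := by
        have aux : ∀ a b : Fin d, (∃ q ∈ WW (d := d) A B (some a) (some b), q * y (some a) = y (some b)) →
            ∃ r, 0 < |h r| ∧ ∃ ε : ℤ, ε.natAbs = 1 ∧ |h r| ^ ε * y (some a) = y (some b) := by
          rintro a b ⟨q, hq, he⟩
          simp only [WW, Finset.mem_union, Finset.mem_image] at hq
          obtain hq | ⟨q, hq, rfl⟩ := hq
          · obtain ⟨r, hr⟩ := hA q hq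
            exact ⟨r, hr ▸ hApos q hq, 1, rfl, by simpa [hr] using he⟩
          · obtain ⟨r, hr⟩ := hA q hq
            exact ⟨r, hr ▸ hApos q hq, -1, rfl, by simpa [hr] using he⟩
        obtain hh | hh := hadj
        · obtain ⟨r, hr, ε, hε, he⟩ := aux _ _ hh
          refine ⟨r, hr, -ε, by simpa using hε, ?_⟩
          rw [← he, ← mul_assoc, ← zpow_add₀ hr.ne']; simp
        · obtain ⟨r, hr, ε, hε, he⟩ := aux _ _ hh
          exact ⟨r, hr, ε, hε, he.symm⟩
      obtain ⟨r, hr, ε, hε, he⟩ := key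
      refine ⟨b, hb, Function.update e r (e r + ε), ?_, ?_⟩
      · have h1 : ∀ f : Fin s → ℤ, ∑ r', (f r').natAbs = (f r).natAbs + ∑ r' ∈ Finset.univ.erase r, (f r').natAbs :=
          fun f => (Finset.add_sum_erase _ _ (Finset.mem_univ r)).symm
        rw [h1] at hlen ⊢
        have h2 : ∑ r' ∈ Finset.univ.erase r, (Function.update e r (e r + ε) r').natAbs
            = ∑ r' ∈ Finset.univ.erase r, (e r').natAbs :=
          Finset.sum_congr rfl fun r' hr' => by
            rw [Function.update_of_ne (Finset.ne_of_mem_erase hr')]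
        rw [h2, Function.update_self, SimpleGraph.Walk.length_cons]
        have := Int.natAbs_add_le (e r) ε
        omega
      · have h1 : ∀ f : Fin s → ℤ, ∏ r', |h r'| ^ (f r') = |h r| ^ (f r) * ∏ r' ∈ Finset.univ.erase r, |h r'| ^ (f r') :=
          fun f => (Finset.mul_prod_erase _ _ (Finset.mem_univ r)).symm
        have h2 : ∏ r' ∈ Finset.univ.erase r, |h r'| ^ (Function.update e r (e r + ε) r')
            = ∏ r' ∈ Finset.univ.erase r, |h r'| ^ (e r') :=
          Finset.prod_congr rfl fun r' hr' => by
            rw [Function.update_of_ne (Finset.ne_of_mem_erase hr')]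
        rw [he, hj, h1, h1 (Function.update _ _ _), h2, Function.update_self, zpow_add₀ hr.ne']
        ring

/-- If the closure of a finite set `Φ` of atomic `τ₀`-constraints over
`v₁,…,v_d` has a simultaneous solution in positive rationals, then it has a
simultaneous solution with all values in `C_{Φ,d}`. -/
theorem closure_solution_in_C {d : ℕ} (hd : 1 ≤ d) (Φ : Finset (Atom d))
    (hwf : ∀ a ∈ Φ, a.WellFormed)
    (hsol : ∃ x : Fin d → ℚ, (∀ i, 0 < x i) ∧ ∀ a ∈ Φ, a.Holds (· ≤ ·) x) :
    ∃ x : Fin d → ℚ, (∀ i, x i ∈ Cset Φ) ∧ ∀ a ∈ Φ, a.Holds (· ≤ ·) x := by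
  classical
  obtain ⟨x, hx, hsat⟩ := hsol
  set HF := (Hset_finite Φ).toFinset with hHF
  set KF := (Kset_finite Φ).toFinset with hKF
  set A : Finset ℚ := HF.image (fun q => |q|) with hA
  set B : Finset ℚ := insert 1 ((KF.filter (fun k => k ≠ 0)).image (fun q => |q|)) with hB
  have hApos : ∀ q ∈ A, 0 < q := by
    intro q hq
    simp only [hA, hHF, Finset.mem_image, Set.Finite.mem_toFinset] at hq
    obtain ⟨_, ⟨c₁, c₂, i, j, s, hm, rfl⟩, rfl⟩ := hq
    obtain ⟨h1, h2, -⟩ := hwf _ hm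
    exact abs_pos.2 (div_ne_zero h1 h2)
  have hBpos : ∀ q ∈ B, 0 < q := by
    intro q hq
    simp only [hB, Finset.mem_insert, Finset.mem_image, Finset.mem_filter] at hq
    obtain rfl | ⟨k, hk, rfl⟩ := hq
    · norm_num
    · exact abs_pos.2 hk.2
  have hBmem : ∀ b ∈ B, ∃ k : ℚ, (k ∈ Kset Φ ∨ k = 1) ∧ b = |k| := by
    intro q hq
    simp only [hB, hKF, Finset.mem_insert, Finset.mem_image, Finset.mem_filter, 
      Set.Finite.mem_toFinset] at hq
    obtain rfl | ⟨k, hk, rfl⟩ := hq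
    · exact ⟨1, Or.inr rfl, by simp⟩
    · exact ⟨k, Or.inl hk.1, rfl⟩
  have hWpos : ∀ u v, ∀ h ∈ WW (d := d) A B u v, 0 < h := by
    intro u v h hh
    rcases u with _ | u <;> rcases v with _ | v <;>
      simp only [WW, Finset.mem_union, Finset.mem_image, Finset.notMem_empty] at hh
    · exact hBpos _ hh
    · obtain ⟨b, hb, rfl⟩ := hh
      exact inv_pos.2 (hBpos _ hb)
    · obtain hh | ⟨b, hb, rfl⟩ := hh
      · exact hApos _ hh
      · exact inv_pos.2 (hApos _ hb)
  have hWinv : ∀ u v, ∀ h ∈ WW (d := d) A B u v, h⁻¹ ∈ WW (d := d) A B v u := by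
    intro u v h hh
    rcases u with _ | u <;> rcases v with _ | v <;>
      simp only [WW, Finset.mem_union, Finset.mem_image, Finset.notMem_empty] at hh ⊢
    · exact ⟨h, hh, rfl⟩
    · obtain ⟨b, hb, rfl⟩ := hh
      simpa using hb
    · obtain hh | ⟨b, hb, rfl⟩ := hh
      · exact Or.inr ⟨h, hh, rfl⟩
      · left; simpa using hb
  have hWne : ∀ v, v ≠ none → (WW (d := d) A B v none).Nonempty := by
    intro v hv
    rcases v with _ | v
    · exact (hv rfl).elim
    · exact ⟨1⁻¹, Finset.mem_image_of_mem _ (Finset.mem_insert_self _ _)⟩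
  obtain ⟨y, hy, hyo, hQ, hreach⟩ := core none (WW (d := d) A B) hWpos hWinv hWne _
    (fun v => v.elim 1 x) (by rintro (_ | v); exacts [one_pos, hx v]) rfl
  simp only [Option.elim_none] at hyo
  refine ⟨fun i => y (some i), ?_, ?_⟩
  · intro i
    obtain ⟨p⟩ := (hreach (some i)).symm
    set h : Fin HF.card → ℚ := fun r => (HF.equivFin.symm r : ℚ) with hh
    have hrange : ∀ q, q ∈ Hset Φ ↔ ∃ r, h r = q := by
      intro q
      constructor
      · intro hq
        have hq' : q ∈ HF := (Hset_finite Φ).mem_toFinset.2 hq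
        exact ⟨HF.equivFin ⟨q, hq'⟩, by simp [hh]⟩
      · rintro ⟨r, rfl⟩
        exact (Hset_finite Φ).mem_toFinset.1 (HF.equivFin.symm r).2
    obtain ⟨b, hb, e, hlen, he⟩ := walk_mono A B h (by
      intro q hq
      obtain ⟨q', hq', rfl⟩ := Finset.mem_image.1 hq
      obtain ⟨r, hr⟩ := (hrange q').1 ((Hset_finite Φ).mem_toFinset.1 hq')
      exact ⟨r, by rw [hr]⟩) hApos hBpos y hyo _ _ p.toPath.1 rfl i rfl
    obtain ⟨k, hk, rfl⟩ := hBmem b hb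
    have hl := p.toPath.2.length_lt
    simp only [Fintype.card_option, Fintype.card_fin] at hl
    refine ⟨k, hk, HF.card, h, e, ?_, hrange, by omega, he⟩
    intro a b hab
    exact HF.equivFin.symm.injective (Subtype.ext hab)
  · -- transfer lemmas
    have tA : ∀ q ∈ A, ∀ i j, (q * x i ≤ x j → q * y (some i) ≤ y (some j)) ∧
        (x j ≤ q * x i → y (some j) ≤ q * y (some i)) := by
      intro q hq i j
      have hq0 := hApos q hq
      refine ⟨hQ (some i) (some j) q (Finset.mem_union_left _ hq), fun hle => ?_⟩
      have := hQ (some j) (some i) q⁻¹ (Finset.mem_union_right _ (Finset.mem_image_of_mem _ hq))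
      simp only [Option.elim_some] at this
      rw [inv_mul_le_iff₀ hq0, inv_mul_le_iff₀ hq0] at this
      exact this hle
    have tB : ∀ q ∈ B, ∀ i, (q ≤ x i → q ≤ y (some i)) ∧ (x i ≤ q → y (some i) ≤ q) := by
      intro q hq i
      have hq0 := hBpos q hq
      constructor
      · have := hQ none (some i) q hq
        simpa [hyo] using this
      · have := hQ (some i) none q⁻¹ (Finset.mem_image_of_mem _ hq)
        simp only [Option.elim_some, Option.elim_none, hyo] at this
        rw [inv_mul_le_iff₀ hq0, inv_mul_le_iff₀ hq0] at this
        simpa using this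
    have tK : ∀ q ∈ Kset Φ, ∀ i, (q ≤ x i → q ≤ y (some i)) ∧ (x i ≤ q → y (some i) ≤ q) := by
      intro q hq i
      have hyi := hy (some i)
      have hxi := hx i
      rcases lt_or_ge 0 q with h0 | h0
      · refine tB q ?_ i
        refine Finset.mem_insert_of_mem (Finset.mem_image.2 ⟨q, ?_, abs_of_pos h0⟩)
        exact Finset.mem_filter.2 ⟨(Kset_finite Φ).mem_toFinset.2 hq, h0.ne'⟩
      · exact ⟨fun _ => by linarith, fun _ => by linarith⟩
    have tc : ∀ c k : ℚ, c ≠ 0 → k / c ∈ Kset Φ → ∀ i, 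
        (c * x i ≤ k → c * y (some i) ≤ k) ∧ (k ≤ c * x i → k ≤ c * y (some i)) := by
      intro c k hc hk i
      obtain ⟨h1, h2⟩ := tK _ hk i
      rcases lt_or_gt_of_ne hc with h0 | h0
      · rw [div_le_iff_of_neg h0, div_le_iff_of_neg h0] at h1
        rw [le_div_iff_of_neg h0, le_div_iff_of_neg h0] at h2
        simp only [mul_comm c]
        exact ⟨h1, h2⟩
      · rw [div_le_iff₀ h0, div_le_iff₀ h0] at h1
        rw [le_div_iff₀ h0, le_div_iff₀ h0] at h2
        simp only [mul_comm c]
        exact ⟨h2, h1⟩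
    intro a ha
    have hs := hsat a ha
    have hw := hwf a ha
    cases a with
    | vk c k i s =>
      obtain ⟨h1, h2⟩ := tc c k hw ⟨c, k, i, s, Or.inl ha, rfl⟩ i
      cases s <;> simp only [Atom.Holds, if_true, Bool.false_eq_true, if_false] at hs ⊢
      · exact le_antisymm (h1 hs.le) (h2 hs.ge)
      · exact h1 hs
    | kv k c i s =>
      obtain ⟨h1, h2⟩ := tc c k hw ⟨c, k, i, s, Or.inr ha, rfl⟩ i
      cases s <;> simp only [Atom.Holds, if_true, Bool.false_eq_true, if_false] at hs ⊢
      · exact le_antisymm (h2 hs.le) (h1 hs.ge)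
      · exact h2 hs
    | vv c₁ c₂ i j s =>
      obtain ⟨hc1, hc2, hn⟩ := hw
      have hxi := hx i
      have hxj := hx j
      have hyi := hy (some i)
      have hyj := hy (some j)
      have hle : c₁ * x i ≤ c₂ * x j := by
        cases s <;> simp only [Atom.Holds, if_true, Bool.false_eq_true, if_false] at hs
        · exact hs.le
        · exact hs
      rcases lt_or_gt_of_ne hc2 with h2 | h2
      · have h1 : 0 < c₁ := lt_of_le_of_ne (not_lt.1 fun h => hn ⟨h, h2⟩) hc1.symm
        have := mul_pos h1 hxi
        have := mul_neg_of_neg_of_pos h2 hxj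
        linarith
      · rcases lt_or_gt_of_ne hc1 with h1 | h1
        · cases s <;> simp only [Atom.Holds, if_true, Bool.false_eq_true, if_false] at hs ⊢
          · have := mul_pos h2 hxj
            have := mul_neg_of_neg_of_pos h1 hxi
            linarith
          · have := mul_pos h2 hyj
            have := mul_neg_of_neg_of_pos h1 hyi
            linarith
        · have hq : c₁ / c₂ ∈ A := Finset.mem_image.2 ⟨c₁ / c₂, 
            (Hset_finite Φ).mem_toFinset.2 ⟨c₁, c₂, i, j, s, ha, rfl⟩, abs_of_pos (div_pos h1 h2)⟩
          obtain ⟨t1, t2⟩ := tA _ hq i j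
          rw [div_mul_eq_mul_div, div_mul_eq_mul_div, div_le_iff₀ h2, div_le_iff₀ h2] at t1
          rw [div_mul_eq_mul_div, div_mul_eq_mul_div, le_div_iff₀ h2, le_div_iff₀ h2] at t2
          simp only [mul_comm _ c₂] at t1 t2
          cases s <;> simp only [Atom.Holds, if_true, Bool.false_eq_true, if_false] at hs ⊢
          · exact le_antisymm (t1 hs.le) (t2 hs.ge)
          · exact t1 hs
end

section
/- Let d ≥ 1 and let Φ be a finite set of atomic τ₁-constraints over variables v₁,…,v_d, interpreted in ℚ((ε)). Suppose there is r ∈ ℚ((ε)) with r > 0 such that every simultaneous solution (x₁,…,x_d) ∈ ℚ((ε))^d of the closure of Φ satisfies 0 < x_i ≤ r for all i. Let u, α₁,…,α_d ∈ ℚ((ε)). If Φ has a simultaneous solution (x₁,…,x_d) ∈ ℚ((ε))^d with Σ_{i=1}^d α_i x_i < u, then the closure of Φ has a simultaneous solution (x'₁,…,x'_d) with all x'_i ∈ C_{Φ,d} and Σ_{i=1}^d α_i x'_i < u. -/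
open scoped Classical

/-- `ℚ((ε))`: the field of formal Laurent series over `ℚ`. -/
abbrev Qstar : Type := LaurentSeries ℚ

/-- The leading coefficient of a Laurent series (its coefficient at the least
exponent with nonzero coefficient; `0` for the zero series). -/
noncomputable def lead (a : Qstar) : ℚ := a.coeff a.order

/-- The order on `ℚ((ε))`: `a < b` iff `b - a` is positive, i.e. iff the
leading coefficient of `b - a` is positive. -/
def QstarLt (a b : Qstar) : Prop := 0 < lead (b - a)

/-- The corresponding non-strict order on `ℚ((ε))`. -/
def QstarLe (a b : Qstar) : Prop := QstarLt a b ∨ a = b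

/-- Absolute value on `ℚ((ε))` with respect to this order. -/
noncomputable def qabs (a : Qstar) : Qstar := if QstarLt a 0 then -a else a

/-- The natural embedding of `ℚ` into `ℚ((ε))`. -/
noncomputable def qc (c : ℚ) : Qstar := HahnSeries.C c

/-- The indeterminate `ε`. -/
noncomputable def eps : Qstar := HahnSeries.single (1 : ℤ) (1 : ℚ)

/-- `ℚ^⋆_{m,n}`: the Laurent series all of whose nonzero coefficients lie in
exponents between `m` and `n`. -/
def QstarBand (m n : ℤ) : Set Qstar := { x | ∀ i : ℤ, x.coeff i ≠ 0 → m ≤ i ∧ i ≤ n }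

/-- An atomic `τ₁`-constraint over variables `v₁,…,v_d`: one of the forms
`c₁·v_i σ c₂·v_j`, `c·v_i σ k`, or `k σ c·v_i`, with nonzero rational
coefficients and constants `k ∈ ℚ^⋆_{−1,1}`; `σ ∈ {<,=}` is encoded by the
Boolean `strict` (`true` for `<`, `false` for `=`). -/
inductive Atom1 (d : ℕ) : Type
  | vv (c₁ c₂ : ℚ) (i j : Fin d) (strict : Bool)
  | vk (c : ℚ) (k : Qstar) (i : Fin d) (strict : Bool)
  | kv (k : Qstar) (c : ℚ) (i : Fin d) (strict : Bool)

/-- Well-formedness: coefficients are nonzero, in two-variable constraints not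
both negative, and constants lie in `ℚ^⋆_{−1,1}`. -/
def Atom1.WellFormed {d : ℕ} : Atom1 d → Prop
  | .vv c₁ c₂ _ _ _ => c₁ ≠ 0 ∧ c₂ ≠ 0 ∧ ¬(c₁ < 0 ∧ c₂ < 0)
  | .vk c k _ _ => c ≠ 0 ∧ k ∈ QstarBand (-1) 1
  | .kv k c _ _ => c ≠ 0 ∧ k ∈ QstarBand (-1) 1

/-- Satisfaction of an atomic `τ₁`-constraint in `ℚ((ε))` under the assignment
`x`, where the strict symbol `<` is interpreted by the relation `lt` (take
`QstarLt` for the constraint itself and `QstarLe` for its closure). -/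
def Atom1.Holds {d : ℕ} (lt : Qstar → Qstar → Prop) (x : Fin d → Qstar) :
    Atom1 d → Prop
  | .vv c₁ c₂ i j s =>
      if s then lt (qc c₁ * x i) (qc c₂ * x j) else qc c₁ * x i = qc c₂ * x j
  | .vk c k i s => if s then lt (qc c * x i) k else qc c * x i = k
  | .kv k c i s => if s then lt k (qc c * x i) else k = qc c * x i

/-- `H(Φ) := {c₁/c₂ : some constraint c₁·v_i σ c₂·v_j is in Φ} ⊆ ℚ`. -/
def Hset1 {d : ℕ} (Φ : Finset (Atom1 d)) : Set ℚ :=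
  { h | ∃ c₁ c₂ i j s, Atom1.vv c₁ c₂ i j s ∈ Φ ∧ h = c₁ / c₂ }

/-- `K(Φ) := {k/c : some constraint c·v_i σ k or k σ c·v_i is in Φ} ⊆ ℚ((ε))`. -/
def Kset1 {d : ℕ} (Φ : Finset (Atom1 d)) : Set Qstar :=
  { q | ∃ c k i s, (Atom1.vk c k i s ∈ Φ ∨ Atom1.kv k c i s ∈ Φ) ∧ q = k / qc c }

/-- `C_{Φ,d} := { |k|·∏_{r=1}^s |h_r|^{e_r} : k ∈ K(Φ) ∪ {1}, e ∈ ℤ^s,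
Σ_r |e_r| < d } ⊆ ℚ((ε))`, where `h₁,…,h_s` is an enumeration of `H(Φ)`. -/
def Cset1 {d : ℕ} (Φ : Finset (Atom1 d)) : Set Qstar :=
  { x | ∃ k : Qstar, (k ∈ Kset1 Φ ∨ k = 1) ∧
      ∃ (s : ℕ) (h : Fin s → ℚ) (e : Fin s → ℤ),
        Function.Injective h ∧ (∀ q, q ∈ Hset1 Φ ↔ ∃ r, h r = q) ∧
        (∑ r, (e r).natAbs) < d ∧
        x = qabs k * qc (∏ r, |h r| ^ (e r)) }

theorem lead_eq (a : Qstar) : lead a = a.leadingCoeff := HahnSeries.leadingCoeff_eq.symm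

theorem lead_add_pos {a b : Qstar} (ha : 0 < lead a) (hb : 0 < lead b) : 0 < lead (a + b) := by
  rw [lead_eq] at *
  have h1 : 0 < toLex a := HahnSeries.leadingCoeff_pos_iff.1 ha
  have h2 : 0 < toLex b := HahnSeries.leadingCoeff_pos_iff.1 hb
  exact HahnSeries.leadingCoeff_pos_iff.2 (add_pos h1 h2)

theorem lead_neg' (a : Qstar) : lead (-a) = - lead a := by
  rw [lead_eq, lead_eq, HahnSeries.leadingCoeff_neg]

theorem lead_mul' (a b : Qstar) : lead (a * b) = lead a * lead b := by
  rw [lead_eq, lead_eq, lead_eq, HahnSeries.leadingCoeff_mul]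

theorem lead_zero_iff (a : Qstar) : lead a = 0 ↔ a = 0 := by
  rw [lead_eq, HahnSeries.leadingCoeff_eq_zero]

theorem lead_qc (c : ℚ) : lead (qc c) = c := by
  rw [lead_eq, qc, HahnSeries.C_apply, HahnSeries.leadingCoeff_of_single]

theorem qlt_trans {a b c : Qstar} (h1 : QstarLt a b) (h2 : QstarLt b c) : QstarLt a c := by
  have := lead_add_pos h1 h2
  unfold QstarLt
  convert this using 2
  ring

theorem qlt_irrefl (a : Qstar) : ¬ QstarLt a a := by
  unfold QstarLt
  rw [sub_self, (lead_zero_iff 0).2 rfl]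
  exact lt_irrefl _

noncomputable instance qLinearOrder : LinearOrder Qstar where
  le := QstarLe
  lt := QstarLt
  le_refl a := Or.inr rfl
  le_trans a b c := by
    rintro (h | rfl) (h' | rfl)
    · exact Or.inl (qlt_trans h h')
    · exact Or.inl h
    · exact Or.inl h'
    · exact Or.inr rfl
  lt_iff_le_not_ge a b := by
    constructor
    · intro h
      refine ⟨Or.inl h, ?_⟩
      rintro (h' | rfl)
      · exact qlt_irrefl _ (qlt_trans h h')
      · exact qlt_irrefl _ h
    · rintro ⟨h | rfl, h'⟩
      · exact h
      · exact absurd (Or.inr rfl) h'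
  le_antisymm a b := by
    rintro (h | rfl) (h' | h')
    · exact absurd (qlt_trans h h') (qlt_irrefl _)
    · exact h'.symm
    · rfl
    · rfl
  le_total a b := by
    rcases lt_trichotomy (lead (b - a)) 0 with h | h | h
    · right; left
      unfold QstarLt
      rw [← neg_sub, lead_neg']
      linarith
    · left; right
      exact (sub_eq_zero.1 ((lead_zero_iff _).1 h)).symm
    · left; left; exact h
  toDecidableLE := Classical.decRel _

theorem qlt_def (a b : Qstar) : a < b ↔ QstarLt a b := Iff.rfl
theorem qle_def (a b : Qstar) : a ≤ b ↔ QstarLe a b := Iff.rfl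

theorem q_pos_iff (a : Qstar) : 0 < a ↔ 0 < lead a := by
  rw [qlt_def, QstarLt, sub_zero]

instance qOrderedAdd : IsOrderedAddMonoid Qstar where
  add_le_add_left a b h c := by
    rcases h with h | rfl
    · left
      unfold QstarLt at *
      convert h using 2
      ring
    · exact le_refl _

instance qZeroLeOne : ZeroLEOneClass Qstar where
  zero_le_one := by
    apply le_of_lt
    rw [q_pos_iff, lead_eq, HahnSeries.leadingCoeff_one]
    exact one_pos

instance qStrict : IsStrictOrderedRing Qstar :=
  IsStrictOrderedRing.of_mul_pos (fun a b ha hb => by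
    rw [q_pos_iff] at *
    rw [lead_mul']
    exact mul_pos ha hb)

theorem vertex {K ι : Type*} [Field K] [LinearOrder K] [IsStrictOrderedRing K] {d : ℕ}
    (Φ : Finset ι) (E : ι → Prop) (g : ι → (Fin d → K) →ₗ[K] K) (b : ι → K) (r u : K)
    (hr : 0 < r) (α : (Fin d → K) →ₗ[K] K) (F : (Fin d → K) → Prop)
    (hF : ∀ x, F x ↔ ∀ a ∈ Φ, 0 ≤ g a x + b a ∧ (E a → g a x + b a = 0))
    (hb : ∀ x, F x → ∀ i, 0 < x i ∧ x i ≤ r)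
    (hs : ∃ x, F x ∧ α x < u) :
    ∃ x, F x ∧ α x < u ∧ ∀ y, (∀ a ∈ Φ, g a x + b a = 0 → g a y = 0) → y = 0 := by
  let T : (Fin d → K) → Finset ι := fun x => Φ.filter (fun a => g a x + b a = 0)
  -- choose a solution with the most tight constraints
  obtain ⟨x, ⟨hx, hxu⟩, hmax⟩ : ∃ x, (F x ∧ α x < u) ∧
      ∀ z, (F z ∧ α z < u) → (T z).card ≤ (T x).card := by
    let S : Set ℕ := {n | ∃ x, (F x ∧ α x < u) ∧ (T x).card = n}
    have hS : S.Nonempty := by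
      obtain ⟨x, hx⟩ := hs
      exact ⟨_, x, hx, rfl⟩
    have hB : BddAbove S := ⟨Φ.card, by
      rintro n ⟨x, -, rfl⟩
      exact Finset.card_filter_le _ _⟩
    obtain ⟨x, hx, hn⟩ := Nat.sSup_mem hS hB
    refine ⟨x, hx, fun z hz => ?_⟩
    rw [hn]
    exact le_csSup hB ⟨z, hz, rfl⟩
  refine ⟨x, hx, hxu, ?_⟩
  -- a direction with nonpositive objective vanishes
  have key : ∀ y, α y ≤ 0 → (∀ a ∈ Φ, g a x + b a = 0 → g a y = 0) → y = 0 := by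
    intro y hy hty
    by_contra hy0
    have hx' := (hF x).1 hx
    by_cases hneg : ∃ a ∈ Φ, g a y < 0
    · let N := Φ.filter (fun a => g a y < 0)
      have hN : N.Nonempty := by
        obtain ⟨a, ha, h⟩ := hneg
        exact ⟨a, Finset.mem_filter.2 ⟨ha, h⟩⟩
      obtain ⟨a, haN, hmin⟩ := Finset.exists_min_image N
        (fun a => (g a x + b a) / (-(g a y))) hN
      obtain ⟨ha, hga⟩ := Finset.mem_filter.1 haN
      set s := (g a x + b a) / (-(g a y)) with hsdef
      have hs0 : 0 ≤ s := div_nonneg (hx' a ha).1 (by linarith)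
      have hval : ∀ c, g c (x + s • y) + b c = (g c x + b c) + s * g c y := by
        intro c
        simp only [map_add, map_smul, smul_eq_mul]
        ring
      have hz : F (x + s • y) := by
        rw [hF]
        intro c hc
        rw [hval]
        refine ⟨?_, ?_⟩
        · by_cases hcy : g c y < 0
          · have := hmin c (Finset.mem_filter.2 ⟨hc, hcy⟩)
            rw [le_div_iff₀ (by linarith)] at this
            linarith
          · have := (hx' c hc).1
            have := mul_nonneg hs0 (not_lt.1 hcy)
            linarith
        · intro hE
          have h0 := (hx' c hc).2 hE
          rw [h0, hty c hc h0]
          ring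
      have hzu : α (x + s • y) < u := by
        simp only [map_add, map_smul, smul_eq_mul]
        have := mul_nonneg hs0 (neg_nonneg.2 hy)
        linarith
      have hcard := hmax _ ⟨hz, hzu⟩
      have hlt : T x ⊂ T (x + s • y) := by
        rw [Finset.ssubset_iff_of_subset]
        · refine ⟨a, Finset.mem_filter.2 ⟨ha, ?_⟩, ?_⟩
          · rw [hval, hsdef]
            have : g a y ≠ 0 := hga.ne
            field_simp
            ring
          · intro h
            have := hty a ha (Finset.mem_filter.1 h).2
            linarith
        · intro c hc
          obtain ⟨hc, h0⟩ := Finset.mem_filter.1 hc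
          refine Finset.mem_filter.2 ⟨hc, ?_⟩
          rw [hval, h0, hty c hc h0]
          ring
      exact absurd hcard (not_le.2 (Finset.card_lt_card hlt))
    · push Not at hneg
      have hray : ∀ s : K, 0 ≤ s → F (x + s • y) := by
        intro s hs0
        rw [hF]
        intro c hc
        have hval : g c (x + s • y) + b c = (g c x + b c) + s * g c y := by
          simp only [map_add, map_smul, smul_eq_mul]
          ring
        rw [hval]
        refine ⟨?_, ?_⟩
        · have := (hx' c hc).1
          have := mul_nonneg hs0 (hneg c hc)
          linarith
        · intro hE
          have h0 := (hx' c hc).2 hE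
          rw [h0, hty c hc h0]
          ring
      obtain ⟨i, hi⟩ : ∃ i, y i ≠ 0 := by
        by_contra h
        push Not at h
        exact hy0 (funext h)
      have hxi := hb x hx i
      rcases lt_or_gt_of_ne hi with hi | hi
      · have := (hb _ (hray (x i / (-(y i))) (div_nonneg hxi.1.le (by linarith))) i).1
        simp only [Pi.add_apply, Pi.smul_apply, smul_eq_mul] at this
        have h2 : x i / (-(y i)) * y i = - x i := by
          field_simp
        linarith
      · have := (hb _ (hray (r / y i) (div_nonneg hr.le hi.le)) i).2
        simp only [Pi.add_apply, Pi.smul_apply, smul_eq_mul] at this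
        have h2 : r / y i * y i = r := by
          field_simp
        linarith [hxi.1]
  intro y hy
  rcases le_total (α y) 0 with h | h
  · exact key y h hy
  · have : -y = 0 := key (-y) (by rw [map_neg]; linarith)
      (fun a ha h0 => by rw [map_neg, hy a ha h0, neg_zero])
    exact neg_eq_zero.1 this

noncomputable def gAtom {d : ℕ} : Atom1 d → (Fin d → Qstar) →ₗ[Qstar] Qstar
  | .vv c₁ c₂ i j _ => qc c₂ • LinearMap.proj j - qc c₁ • LinearMap.proj i
  | .vk c _ i _ => - (qc c • LinearMap.proj i)
  | .kv _ c i _ => qc c • LinearMap.proj i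

noncomputable def bAtom {d : ℕ} : Atom1 d → Qstar
  | .vv _ _ _ _ _ => 0
  | .vk _ k _ _ => k
  | .kv k _ _ _ => -k

def eAtom {d : ℕ} : Atom1 d → Prop
  | .vv _ _ _ _ s => s = false
  | .vk _ _ _ s => s = false
  | .kv _ _ _ s => s = false

theorem holds_iff {d : ℕ} (a : Atom1 d) (x : Fin d → Qstar) :
    a.Holds QstarLe x ↔ 0 ≤ gAtom a x + bAtom a ∧ (eAtom a → gAtom a x + bAtom a = 0) := by
  cases a with
  | vv c₁ c₂ i j s =>
    cases s
    · simp only [Atom1.Holds, gAtom, bAtom, eAtom, LinearMap.sub_apply, LinearMap.smul_apply,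
        LinearMap.proj_apply, smul_eq_mul]
      constructor
      · intro h
        simp at h
        simp [h]
      · rintro ⟨-, h⟩
        have := h trivial
        simp
        linear_combination -this
    · simp only [Atom1.Holds, gAtom, bAtom, eAtom, LinearMap.sub_apply, LinearMap.smul_apply,
        LinearMap.proj_apply, smul_eq_mul, ← qle_def]
      simp
  | vk c k i s =>
    cases s
    · simp only [Atom1.Holds, gAtom, bAtom, eAtom, LinearMap.neg_apply, LinearMap.smul_apply,
        LinearMap.proj_apply, smul_eq_mul]
      constructor
      · intro h
        simp at h
        simp [h]
      · rintro ⟨-, h⟩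
        have := h trivial
        simp
        linear_combination -this
    · simp only [Atom1.Holds, gAtom, bAtom, eAtom, LinearMap.neg_apply, LinearMap.smul_apply,
        LinearMap.proj_apply, smul_eq_mul, ← qle_def]
      simp
  | kv k c i s =>
    cases s
    · simp only [Atom1.Holds, gAtom, bAtom, eAtom, LinearMap.smul_apply,
        LinearMap.proj_apply, smul_eq_mul]
      constructor
      · intro h
        simp at h
        simp [h]
      · rintro ⟨-, h⟩
        have := h trivial
        simp
        linear_combination -this
    · simp only [Atom1.Holds, gAtom, bAtom, eAtom, LinearMap.smul_apply,
        LinearMap.proj_apply, smul_eq_mul, ← qle_def]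
      simp

theorem holds_le_of_lt {d : ℕ} (a : Atom1 d) (x : Fin d → Qstar)
    (h : a.Holds QstarLt x) : a.Holds QstarLe x := by
  cases a with
  | vv c₁ c₂ i j s =>
    cases s
    · exact h
    · exact Or.inl h
  | vk c k i s =>
    cases s
    · exact h
    · exact Or.inl h
  | kv k c i s =>
    cases s
    · exact h
    · exact Or.inl h

theorem qc_mul (a b : ℚ) : qc (a * b) = qc a * qc b := map_mul HahnSeries.C a b
theorem qc_one : qc 1 = 1 := map_one HahnSeries.C
theorem qc_div (a b : ℚ) : qc (a / b) = qc a / qc b :=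
  map_div₀ (HahnSeries.C : ℚ →+* Qstar) a b
theorem qc_inv (a : ℚ) : qc (a⁻¹) = (qc a)⁻¹ :=
  map_inv₀ (HahnSeries.C : ℚ →+* Qstar) a
theorem qc_pos {c : ℚ} : 0 < qc c ↔ 0 < c := by rw [q_pos_iff, lead_qc]
theorem qc_ne {c : ℚ} (h : c ≠ 0) : qc c ≠ 0 := by
  intro h0
  apply h
  rw [← lead_qc c, h0, (lead_zero_iff 0).2 rfl]

theorem qabs_of_pos {a : Qstar} (h : 0 < a) : qabs a = a := by
  unfold qabs
  rw [if_neg]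
  exact fun h' => absurd h (not_lt.2 (le_of_lt ((qlt_def _ _).2 h')))

theorem hset_finite {d : ℕ} (Φ : Finset (Atom1 d)) : (Hset1 Φ).Finite := by
  refine (Φ.finite_toSet.image (fun a => match a with
    | .vv c₁ c₂ _ _ _ => c₁ / c₂
    | .vk _ _ _ _ => 0
    | .kv _ _ _ _ => 0)).subset ?_
  rintro h ⟨c₁, c₂, i, j, s, hm, rfl⟩
  exact ⟨_, hm, rfl⟩

theorem walk_prod {d s : ℕ} (G : SimpleGraph (Fin d)) (x : Fin d → Qstar) (h : Fin s → ℚ)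
    (hG : ∀ i j, G.Adj i j → ∃ r, h r ≠ 0 ∧
      (x i = qc |h r| * x j ∨ x j = qc |h r| * x i)) :
    ∀ (i j : Fin d) (p : G.Walk i j), ∃ e : Fin s → ℤ, (∀ r, e r ≠ 0 → h r ≠ 0) ∧
      ∑ r, (e r).natAbs ≤ p.length ∧ x i = x j * qc (∏ r, |h r| ^ (e r)) := by
  intro i j p
  induction p with
  | nil => exact ⟨0, by simp, by simp, by simp [qc_one]⟩
  | @cons i m j hadj p ih =>
    obtain ⟨e, he0, hesum, hex⟩ := ih
    obtain ⟨r, hr0, hr⟩ := hG _ _ hadj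
    obtain ⟨δ, hδ, hx⟩ : ∃ δ : ℤ, δ.natAbs = 1 ∧ x i = x m * qc (|h r| ^ δ) := by
      rcases hr with hr | hr
      · exact ⟨1, rfl, by rw [zpow_one, hr, mul_comm]⟩
      · refine ⟨-1, rfl, ?_⟩
        rw [zpow_neg_one, qc_inv, hr]
        have := qc_ne (abs_ne_zero.2 hr0)
        field_simp
    have hsplit : ∀ t, |h t| ^ ((e + Pi.single r δ : Fin s → ℤ) t) = |h t| ^ (e t) * (if t = r then |h r| ^ δ else 1) := by
      intro t
      by_cases ht : t = r
      · subst ht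
        rw [if_pos rfl, Pi.add_apply, Pi.single_eq_same, zpow_add₀ (abs_ne_zero.2 hr0)]
      · rw [if_neg ht, Pi.add_apply, Pi.single_eq_of_ne ht, add_zero, mul_one]
    refine ⟨e + Pi.single r δ, ?_, ?_, ?_⟩
    · intro t ht
      by_cases htr : t = r
      · subst htr; exact hr0
      · apply he0
        simpa [Pi.single_eq_of_ne htr] using ht
    · have h1 : ∀ t, ((e + Pi.single r δ : Fin s → ℤ) t).natAbs ≤ (e t).natAbs + (if t = r then 1 else 0) := by
        intro t
        by_cases ht : t = r
        · subst ht
          rw [if_pos rfl, Pi.add_apply, Pi.single_eq_same]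
          have := Int.natAbs_add_le (e t) δ
          omega
        · rw [if_neg ht, Pi.add_apply, Pi.single_eq_of_ne ht, add_zero]
          omega
      calc ∑ t, ((e + Pi.single r δ : Fin s → ℤ) t).natAbs
          ≤ ∑ t, ((e t).natAbs + (if t = r then 1 else 0)) := Finset.sum_le_sum fun t _ => h1 t
        _ = ∑ t, (e t).natAbs + 1 := by rw [Finset.sum_add_distrib]; simp
        _ ≤ _ := by rw [SimpleGraph.Walk.length_cons]; omega
    · simp_rw [hsplit]
      rw [Finset.prod_mul_distrib, qc_mul, hx, hex]
      simp
      ring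

/-- Suppose every solution of the closure of `Φ` in `ℚ((ε))` lies in
`(0, r]^d`. If `Φ` has a solution with `Σ αᵢxᵢ < u`, then the closure of `Φ`
has a solution with all values in `C_{Φ,d}` and `Σ αᵢx'ᵢ < u`. -/
theorem closure_solution_in_C1 {d : ℕ} (hd : 1 ≤ d) (Φ : Finset (Atom1 d))
    (hwf : ∀ a ∈ Φ, a.WellFormed)
    (r : Qstar) (hr : QstarLt 0 r)
    (hbound : ∀ x : Fin d → Qstar, (∀ a ∈ Φ, a.Holds QstarLe x) →
      ∀ i, QstarLt 0 (x i) ∧ QstarLe (x i) r)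
    (u : Qstar) (α : Fin d → Qstar)
    (hsol : ∃ x : Fin d → Qstar, (∀ a ∈ Φ, a.Holds QstarLt x) ∧
      QstarLt (∑ i, α i * x i) u) :
    ∃ x : Fin d → Qstar, (∀ i, x i ∈ Cset1 Φ) ∧ (∀ a ∈ Φ, a.Holds QstarLe x) ∧
      QstarLt (∑ i, α i * x i) u := by
  obtain ⟨x₀, hx₀, hxu₀⟩ := hsol
  obtain ⟨x, hx, hxu, hker⟩ := vertex Φ eAtom gAtom bAtom r u hr
    (∑ i, α i • LinearMap.proj i) (fun x => ∀ a ∈ Φ, a.Holds QstarLe x)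
    (fun x => forall₂_congr fun a _ => holds_iff a x) hbound
    ⟨x₀, fun a ha => holds_le_of_lt a x₀ (hx₀ a ha), by
      simpa [LinearMap.sum_apply] using (qlt_def _ _).2 hxu₀⟩
  have hpos : ∀ i, 0 < x i := fun i => (hbound x hx i).1
  refine ⟨x, ?_, hx, by
      have h2 : ∑ i, α i * x i < u := by simpa [LinearMap.sum_apply] using hxu
      exact h2⟩
  have hfin := hset_finite Φ
  haveI := hfin.to_subtype
  obtain ⟨s, ⟨φ⟩⟩ := Finite.exists_equiv_fin (Hset1 Φ)
  let h : Fin s → ℚ := fun t => (φ.symm t : ℚ)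
  have hinj : Function.Injective h := Subtype.val_injective.comp φ.symm.injective
  have hran : ∀ q, q ∈ Hset1 Φ ↔ ∃ t, h t = q := by
    intro q
    constructor
    · intro hq
      exact ⟨φ ⟨q, hq⟩, by simp [h]⟩
    · rintro ⟨t, rfl⟩
      exact (φ.symm t).2
  let G : SimpleGraph (Fin d) := SimpleGraph.fromRel (fun i j =>
    ∃ t, h t ≠ 0 ∧ x i = qc |h t| * x j)
  have hG : ∀ i j, G.Adj i j → ∃ t, h t ≠ 0 ∧
      (x i = qc |h t| * x j ∨ x j = qc |h t| * x i) := by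
    intro i j hij
    rw [SimpleGraph.fromRel_adj] at hij
    rcases hij.2 with ⟨t, h0, ht⟩ | ⟨t, h0, ht⟩
    · exact ⟨t, h0, Or.inl ht⟩
    · exact ⟨t, h0, Or.inr ht⟩
  -- tight two-variable constraints give edges
  have hedge : ∀ c₁ c₂ i j b, Atom1.vv c₁ c₂ i j b ∈ Φ → qc c₂ * x j = qc c₁ * x i →
      i ≠ j → G.Adj i j := by
    intro c₁ c₂ i j b hm heq hne
    obtain ⟨h1, h2, -⟩ := hwf _ hm
    rw [SimpleGraph.fromRel_adj]
    refine ⟨hne, Or.inr ?_⟩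
    obtain ⟨t, ht⟩ := (hran (c₁ / c₂)).1 ⟨c₁, c₂, i, j, b, hm, rfl⟩
    have hxj : x j = qc (c₁ / c₂) * x i := by
      rw [qc_div]
      have := qc_ne h2
      field_simp
      linear_combination heq
    have hp : 0 < c₁ / c₂ := by
      rw [← qc_pos]
      by_contra hn
      have := mul_nonpos_of_nonpos_of_nonneg (not_lt.1 hn) (hpos i).le
      rw [← hxj] at this
      exact absurd (hpos j) (not_lt.2 this)
    refine ⟨t, ?_, ?_⟩
    · rw [ht]; exact hp.ne'
    · rw [ht, abs_of_pos hp]; exact hxj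
  have hanch : ∀ i, ∃ j, G.Reachable i j ∧ x j ∈ Kset1 Φ := by
    intro i
    by_contra hno
    push Not at hno
    let y : Fin d → Qstar := fun j => if G.Reachable i j then x j else 0
    have hy : y = 0 := by
      apply hker
      intro a ha h0
      cases a with
      | vv c₁ c₂ j k b =>
        simp only [gAtom, bAtom, LinearMap.sub_apply, LinearMap.smul_apply,
          LinearMap.proj_apply, smul_eq_mul, add_zero] at h0 ⊢
        have hiff : G.Reachable i j ↔ G.Reachable i k := by
          by_cases hjk : j = k
          · rw [hjk]
          · have hr' := (hedge _ _ _ _ _ ha (sub_eq_zero.1 h0) hjk).reachable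
            exact ⟨fun h => h.trans hr', fun h => h.trans hr'.symm⟩
        by_cases hj : G.Reachable i j
        · simp only [y, if_pos hj, if_pos (hiff.1 hj)]
          exact h0
        · simp only [y, if_neg hj, if_neg (fun h => hj (hiff.2 h))]
          simp
      | vk c k j b =>
        simp only [gAtom, bAtom, LinearMap.neg_apply, LinearMap.smul_apply,
          LinearMap.proj_apply, smul_eq_mul] at h0 ⊢
        have hj : ¬ G.Reachable i j := by
          intro hj
          refine hno j hj ⟨c, k, j, b, Or.inl ha, ?_⟩
          have := qc_ne (hwf _ ha).1
          field_simp
          linear_combination -h0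
        simp [y, if_neg hj]
      | kv k c j b =>
        simp only [gAtom, bAtom, LinearMap.smul_apply,
          LinearMap.proj_apply, smul_eq_mul] at h0 ⊢
        have hj : ¬ G.Reachable i j := by
          intro hj
          refine hno j hj ⟨c, k, j, b, Or.inr ha, ?_⟩
          have := qc_ne (hwf _ ha).1
          field_simp
          linear_combination h0
        simp [y, if_neg hj]
    have h1 : y i = 0 := congrFun hy i
    simp only [y, if_pos (SimpleGraph.Reachable.refl i)] at h1
    exact (hpos i).ne' h1
  intro i
  obtain ⟨j, hij, hK⟩ := hanch i
  obtain ⟨p, hp⟩ := hij.exists_isPath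
  obtain ⟨e, -, hesum, hex⟩ := walk_prod G x h hG i j p
  refine ⟨x j, Or.inl hK, s, h, e, hinj, hran, ?_, ?_⟩
  · have := hp.length_lt
    rw [Fintype.card_fin] at this
    omega
  · rw [qabs_of_pos (hpos j)]
    exact hex
end
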